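/- arXiv:1803.08658 — 3 statements merged into one kernel-verified Lean document; each statement's English description precedes it below -/
import Mathlib

section
/- For any simple graph G and any chordal proper spanning subgraph Q of G, the inequality P'(G, x)/P(G, x) > P'(Q, x)/P(Q, x) holds for all real x < 0. -/
open Polynomial

/-- `P` is the chromatic polynomial of `G`: for every natural number `k`,
`P` evaluated at `k` equals the number of proper `k`-colorings of `G`. -/
def IsChromPoly {W : Type*} (G : SimpleGraph W) (P : Polynomial ℝ) : Prop :=
  ∀ k : ℕ, P.eval (k : ℝ) = (Nat.card (G.Coloring (Fin k)) : ℝ)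

/-- A graph is chordal if every cycle of length at least 4 has a chord. -/
def IsChordal {W : Type*} (Q : SimpleGraph W) : Prop :=
  ∀ (v : W) (w : Q.Walk v v), w.IsCycle → 4 ≤ w.length →
    ∃ a b, a ∈ w.support ∧ b ∈ w.support ∧ Q.Adj a b ∧ s(a, b) ∉ w.edges

/-- Real-valued functions on finite sets, multiplied by convolution over disjoint decompositions. -/
def SetFun (V : Type*) := Finset V → ℝ

namespace SetFun

noncomputable instance {V : Type*} : AddCommGroup (SetFun V) :=
  inferInstanceAs (AddCommGroup (Finset V → ℝ))

noncomputable instance {V : Type*} : Module ℝ (SetFun V) :=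
  inferInstanceAs (Module ℝ (Finset V → ℝ))

variable {V : Type*}

@[ext] theorem ext {f g : SetFun V} (h : ∀ S, f S = g S) : f = g := funext h

@[simp] theorem add_apply (f g : SetFun V) (S : Finset V) : (f + g) S = f S + g S := rfl
@[simp] theorem neg_apply (f : SetFun V) (S : Finset V) : (-f) S = -f S := rfl
@[simp] theorem sub_apply (f g : SetFun V) (S : Finset V) : (f - g) S = f S - g S := rfl
@[simp] theorem zero_apply (S : Finset V) : (0 : SetFun V) S = 0 := rfl
@[simp] theorem smul_apply (c : ℝ) (f : SetFun V) (S : Finset V) : (c • f) S = c * f S := rfl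

theorem sum_apply {ι : Type*} (s : Finset ι) (f : ι → SetFun V) (S : Finset V) :
    (∑ i ∈ s, f i) S = ∑ i ∈ s, f i S :=
  Finset.sum_apply (M := fun _ : Finset V => ℝ) S s f

/-- Multiplication of values by the parity sign of the argument. -/
noncomputable def twist (f : SetFun V) : SetFun V := fun S => (-1) ^ S.card * f S

theorem twist_apply (f : SetFun V) (S : Finset V) : twist f S = (-1) ^ S.card * f S := rfl

theorem twist_smul (c : ℝ) (f : SetFun V) : twist (c • f) = c • twist f := by
  ext S; simp [twist_apply]; ring

variable [DecidableEq V]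

noncomputable instance : One (SetFun V) := ⟨fun S => if S = ∅ then 1 else 0⟩

noncomputable instance : Mul (SetFun V) :=
  ⟨fun f g S => ∑ A ∈ S.powerset, f A * g (S \ A)⟩

theorem one_apply (S : Finset V) : (1 : SetFun V) S = if S = ∅ then 1 else 0 := rfl

theorem mul_apply (f g : SetFun V) (S : Finset V) :
    (f * g) S = ∑ A ∈ S.powerset, f A * g (S \ A) := rfl

protected theorem mul_comm' (f g : SetFun V) : f * g = g * f := by
  ext S
  simp only [mul_apply]
  refine Finset.sum_nbij' (fun A => S \ A) (fun A => S \ A) ?_ ?_ ?_ ?_ ?_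
  · intro A _; simp
  · intro A _; simp
  · intro A hA; exact Finset.sdiff_sdiff_eq_self (Finset.mem_powerset.1 hA)
  · intro A hA; exact Finset.sdiff_sdiff_eq_self (Finset.mem_powerset.1 hA)
  · intro A hA
    rw [Finset.sdiff_sdiff_eq_self (Finset.mem_powerset.1 hA), mul_comm]

protected theorem mul_assoc' (f g h : SetFun V) : f * g * h = f * (g * h) := by
  ext S
  simp only [mul_apply, Finset.sum_mul, Finset.mul_sum]
  rw [Finset.sum_sigma', Finset.sum_sigma']
  refine Finset.sum_nbij' (fun x => ⟨x.2, x.1 \ x.2⟩) (fun x => ⟨x.1 ∪ x.2, x.1⟩) ?_ ?_ ?_ ?_ ?_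
  · rintro ⟨A, B⟩ h
    simp only [Finset.mem_sigma, Finset.mem_powerset] at h ⊢
    exact ⟨h.2.trans h.1, Finset.sdiff_subset_sdiff h.1 le_rfl⟩
  · rintro ⟨A, B⟩ h
    simp only [Finset.mem_sigma, Finset.mem_powerset] at h ⊢
    exact ⟨Finset.union_subset h.1 (h.2.trans Finset.sdiff_subset), Finset.subset_union_left⟩
  · rintro ⟨A, B⟩ h
    simp only [Finset.mem_sigma, Finset.mem_powerset] at h
    simp [Finset.union_sdiff_of_subset h.2]
  · rintro ⟨A, B⟩ h
    simp only [Finset.mem_sigma, Finset.mem_powerset] at h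
    have : Disjoint B A := (Finset.subset_sdiff.1 h.2).2
    simp [Finset.union_sdiff_left, Finset.sdiff_eq_self_of_disjoint this]
  · rintro ⟨A, B⟩ h
    simp only [Finset.mem_sigma, Finset.mem_powerset] at h
    have : S \ A = (S \ B) \ (A \ B) := by
      rw [sdiff_sdiff_left, Finset.sup_eq_union, Finset.union_sdiff_of_subset h.2]
    simp only [this, mul_assoc]

protected theorem one_mul' (f : SetFun V) : 1 * f = f := by
  ext S
  rw [mul_apply, Finset.sum_eq_single ∅]
  · simp [one_apply]
  · intro A _ hA; simp [one_apply, hA]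
  · simp

protected theorem left_distrib' (f g h : SetFun V) : f * (g + h) = f * g + f * h := by
  ext S; simp [mul_apply, mul_add, Finset.sum_add_distrib]

protected theorem zero_mul' (f : SetFun V) : 0 * f = 0 := by
  ext S; simp [mul_apply]

noncomputable instance : CommRing (SetFun V) :=
  { (inferInstance : AddCommGroup (SetFun V)) with
    mul_assoc := SetFun.mul_assoc'
    mul_comm := SetFun.mul_comm'
    one_mul := SetFun.one_mul'
    mul_one := fun f => (SetFun.mul_comm' f 1).trans (SetFun.one_mul' f)
    zero_mul := SetFun.zero_mul'
    mul_zero := fun f => (SetFun.mul_comm' f 0).trans (SetFun.zero_mul' f)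
    left_distrib := SetFun.left_distrib'
    right_distrib := fun f g h => by
      rw [SetFun.mul_comm', SetFun.left_distrib', SetFun.mul_comm' h f, SetFun.mul_comm' h g] }

noncomputable instance : Algebra ℝ (SetFun V) :=
  Algebra.ofModule
    (fun c f g => by ext S; simp [mul_apply, Finset.mul_sum, mul_assoc])
    (fun c f g => by ext S; simp [mul_apply, Finset.mul_sum, mul_left_comm])

/-- The restriction of `f` to the sets containing `K`. -/
noncomputable def mark (K : Finset V) (f : SetFun V) : SetFun V :=
  fun S => if K ⊆ S then f S else 0

theorem mark_apply (K : Finset V) (f : SetFun V) (S : Finset V) :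
    mark K f S = if K ⊆ S then f S else 0 := rfl

theorem mark_smul (K : Finset V) (c : ℝ) (f : SetFun V) : mark K (c • f) = c • mark K f := by
  ext S; simp [mark_apply]

theorem mark_mark (v : V) (K : Finset V) (f : SetFun V) :
    mark {v} (mark K f) = mark (insert v K) f := by
  ext S
  simp only [mark_apply, Finset.insert_subset_iff, Finset.singleton_subset_iff]
  split_ifs <;> simp_all

theorem mark_singleton_mul (v : V) (f g : SetFun V) :
    mark {v} (f * g) = mark {v} f * g + f * mark {v} g := by
  ext S
  simp only [mark_apply, add_apply, mul_apply, Finset.singleton_subset_iff, Finset.mem_sdiff]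
  rw [← Finset.sum_add_distrib]
  split_ifs with h
  · refine Finset.sum_congr rfl fun A _ => ?_
    by_cases hA : v ∈ A <;> simp [hA, h]
  · refine (Finset.sum_eq_zero fun A hA => ?_).symm
    have : v ∉ A := fun hv => h (Finset.mem_powerset.1 hA hv)
    simp [h, this]

theorem mark_singleton_mul_apply_of_notMem {v : V} {S : Finset V} (hv : v ∉ S) (f g : SetFun V) :
    (mark {v} f * g) S = 0 := by
  rw [mul_apply]
  refine Finset.sum_eq_zero fun A hA => ?_
  have : v ∉ A := fun h => hv (Finset.mem_powerset.1 hA h)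
  simp [mark_apply, this]

theorem mark_mul_of_disjoint (K : Finset V) (f g : SetFun V)
    (hf : ∀ A, f A ≠ 0 → Disjoint K A) : mark K (f * g) = f * mark K g := by
  ext S
  simp only [mark_apply, mul_apply, Finset.subset_sdiff]
  split_ifs with h
  · refine Finset.sum_congr rfl fun A _ => ?_
    by_cases hA : f A = 0
    · simp [hA]
    · simp [h, hf A hA]
  · simp [h]

theorem mark_singleton_pow (v : V) (f : SetFun V) (k : ℕ) :
    mark {v} (f ^ (k + 1)) = ((k : ℝ) + 1) • (mark {v} f * f ^ k) := by
  induction k with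
  | zero => simp
  | succ k ih =>
    rw [pow_succ, mark_singleton_mul, ih, Nat.cast_succ, add_smul (_ + 1 : ℝ) 1, one_smul,
      smul_mul_assoc, mul_assoc, ← pow_succ, mul_comm (f ^ (k + 1))]

theorem mark_twist (K : Finset V) (f : SetFun V) : mark K (twist f) = twist (mark K f) := by
  ext S; simp [twist_apply, mark_apply]

theorem twist_mul (f g : SetFun V) : twist (f * g) = twist f * twist g := by
  ext S
  simp only [twist_apply, mul_apply, Finset.mul_sum]
  refine Finset.sum_congr rfl fun A hA => ?_
  rw [← Finset.card_sdiff_add_card_eq_card (Finset.mem_powerset.1 hA), pow_add]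
  ring

end SetFun

theorem Polynomial.ext_eval_nat {p q : ℝ[X]} (h : ∀ k : ℕ, p.eval (k : ℝ) = q.eval (k : ℝ)) :
    p = q :=
  Polynomial.eq_of_infinite_eval_eq p q <|
    (Set.infinite_range_of_injective Nat.cast_injective).mono (by rintro _ ⟨k, rfl⟩; exact h k)

namespace SetFun

variable {V : Type*}

/-- Pointwise evaluation of a family of polynomials. -/
noncomputable def evalFun (P : Finset V → ℝ[X]) (x : ℝ) : SetFun V := fun S => (P S).eval x

/-- The linear coefficients of a family of polynomials. -/
noncomputable def linFun (P : Finset V → ℝ[X]) : SetFun V := fun S => (derivative (P S)).eval 0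

theorem evalFun_apply (P : Finset V → ℝ[X]) (x : ℝ) (S : Finset V) :
    evalFun P x S = (P S).eval x := rfl

theorem linFun_apply (P : Finset V → ℝ[X]) (S : Finset V) :
    linFun P S = (derivative (P S)).eval 0 := rfl

variable [DecidableEq V]

/-- The polynomials `P S` interpolate the natural powers of `f`. -/
def IsPowPoly (f : SetFun V) (P : Finset V → ℝ[X]) : Prop :=
  ∀ S (k : ℕ), (P S).eval (k : ℝ) = (f ^ k) S

theorem one_pow_apply_empty (f : SetFun V) (hf : f ∅ = 1) (k : ℕ) : (f ^ k) ∅ = 1 := by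
  induction k with
  | zero => simp [one_apply]
  | succ k ih =>
    rw [pow_succ, mul_apply, Finset.powerset_empty, Finset.sum_singleton, ih, Finset.sdiff_self, hf,
      mul_one]

theorem exists_isPowPoly (f : SetFun V) (hf : f ∅ = 1) : ∃ P, IsPowPoly f P := by
  have key : ∀ S : Finset V, ∃ p : ℝ[X], ∀ k : ℕ, p.eval (k : ℝ) = (f ^ k) S := by
    intro S
    induction S using Finset.strongInduction with
    | H S ih =>
      rcases S.eq_empty_or_nonempty with rfl | ⟨v, hv⟩
      · exact ⟨1, fun k => by simp [one_pow_apply_empty f hf]⟩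
      · have : ∀ A : Finset V, ∃ p : ℝ[X], v ∈ A → A ⊆ S → ∀ k : ℕ,
            p.eval (k : ℝ) = (f ^ k) (S \ A) := by
          intro A
          by_cases h : v ∈ A ∧ A ⊆ S
          · obtain ⟨p, hp⟩ := ih (S \ A) (Finset.sdiff_ssubset h.2 ⟨v, h.1⟩)
            exact ⟨p, fun _ _ => hp⟩
          · exact ⟨0, fun h1 h2 => absurd ⟨h1, h2⟩ h⟩
        choose p hp using this
        refine ⟨X * ∑ A ∈ S.powerset, C (mark {v} f A) * (p A).comp (X - 1), fun k => ?_⟩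
        cases k with
        | zero =>
          have : S ≠ ∅ := Finset.ne_empty_of_mem hv
          simp [one_apply, this]
        | succ k =>
          have h1 : (f ^ (k + 1)) S = mark {v} (f ^ (k + 1)) S := by simp [mark_apply, hv]
          rw [h1, mark_singleton_pow]
          simp only [eval_mul, eval_X, eval_finsetSum, eval_C, eval_comp, eval_sub, eval_one,
            smul_apply, mul_apply, Nat.cast_succ, add_sub_cancel_right]
          congr 1
          refine Finset.sum_congr rfl fun A hA => ?_
          by_cases hvA : v ∈ A
          · rw [hp A hvA (Finset.mem_powerset.1 hA)]
          · simp [mark_apply, hvA]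
  choose P hP using key
  exact ⟨P, hP⟩

namespace IsPowPoly

variable {f : SetFun V} {P : Finset V → ℝ[X]}

theorem evalFun_natCast (h : IsPowPoly f P) (k : ℕ) : evalFun P k = f ^ k := by
  ext S; exact h S k

theorem evalFun_zero (h : IsPowPoly f P) : evalFun P 0 = 1 := by
  simpa using h.evalFun_natCast 0

theorem evalFun_one (h : IsPowPoly f P) : evalFun P 1 = f := by
  simpa using h.evalFun_natCast 1

theorem comp_add (h : IsPowPoly f P) (S : Finset V) (z : ℝ) :
    (P S).comp (X + C z) = ∑ A ∈ S.powerset, P A * C ((P (S \ A)).eval z) := by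
  refine Polynomial.ext_eval_nat fun j => ?_
  have : (P S).comp (C (j : ℝ) + X) = ∑ A ∈ S.powerset, C ((P A).eval (j : ℝ)) * P (S \ A) := by
    refine Polynomial.ext_eval_nat fun k => ?_
    have := congr_fun (pow_add f j k) S
    rw [mul_apply] at this
    simp only [eval_comp, eval_add, eval_C, eval_X, eval_finsetSum, eval_mul, h _ j, h _ k]
    rw [← this, ← h, Nat.cast_add]
  have := congr_arg (eval z) this
  simpa [eval_finsetSum, eval_comp] using this

theorem evalFun_add (h : IsPowPoly f P) (x z : ℝ) :
    evalFun P (x + z) = evalFun P x * evalFun P z := by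
  ext S
  have := congr_arg (eval x) (h.comp_add S z)
  simpa [eval_finsetSum, eval_comp, evalFun_apply, mul_apply] using this

theorem derivative_eval (h : IsPowPoly f P) (S : Finset V) (x : ℝ) :
    (derivative (P S)).eval x = (linFun P * evalFun P x) S := by
  have := congr_arg (fun p => eval 0 (derivative p)) (h.comp_add S x)
  simpa [eval_finsetSum, eval_comp, derivative_comp, derivative_sum, evalFun_apply,
    linFun_apply, mul_apply] using this

theorem eq_X_mul (h : IsPowPoly f P) {v : V} {S : Finset V} (hv : v ∈ S) :
    P S = X * ∑ A ∈ S.powerset, C (mark {v} f A) * (P (S \ A)).comp (X - 1) := by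
  refine Polynomial.ext_eval_nat fun k => ?_
  have h1 : (f ^ k) S = mark {v} (f ^ k) S := by simp [mark_apply, hv]
  rw [h, h1]
  cases k with
  | zero =>
    have : S ≠ ∅ := Finset.ne_empty_of_mem hv
    simp [one_apply, this, mark_apply]
  | succ k =>
    rw [mark_singleton_pow]
    simp [eval_finsetSum, eval_comp, mul_apply, h _ k]

theorem mark_evalFun_eq (h : IsPowPoly f P) (v : V) (x : ℝ) :
    mark {v} (evalFun P x) = x • (mark {v} f * evalFun P (x - 1)) := by
  ext S
  by_cases hv : v ∈ S
  · have := congr_arg (eval x) (h.eq_X_mul hv)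
    simpa [eval_finsetSum, eval_comp, mul_apply, mark_apply, hv, evalFun_apply] using this
  · simp [mark_singleton_mul_apply_of_notMem hv, mark_apply, hv]

theorem mark_linFun (h : IsPowPoly f P) (v : V) :
    mark {v} (linFun P) = mark {v} f * evalFun P (-1) := by
  ext S
  by_cases hv : v ∈ S
  · have := congr_arg (fun p => eval 0 (derivative p)) (h.eq_X_mul hv)
    simpa [eval_finsetSum, eval_comp, mul_apply, mark_apply, hv, evalFun_apply, linFun_apply]
      using this
  · simp [mark_singleton_mul_apply_of_notMem hv, mark_apply, hv]

theorem mark_evalFun (h : IsPowPoly f P) (v : V) (x : ℝ) :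
    mark {v} (evalFun P x) = x • (mark {v} (linFun P) * evalFun P x) := by
  rw [h.mark_evalFun_eq, h.mark_linFun, mul_assoc, ← h.evalFun_add, neg_add_eq_sub]

end IsPowPoly

end SetFun

section Indep

open SetFun

variable {V : Type*}

open Classical in
/-- The indicator function of the independent sets of `G`. -/
noncomputable def SimpleGraph.indepFun (G : SimpleGraph V) : SetFun V :=
  fun S => if G.IsIndepSet (S : Set V) then 1 else 0

/-- The polynomials `P S` interpolate the numbers of proper colorings of the subgraphs `G[S]`. -/
abbrev IsColPoly [DecidableEq V] (G : SimpleGraph V) (P : Finset V → ℝ[X]) : Prop :=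
  IsPowPoly G.indepFun P

/-- The absolute values of the linear coefficients of the chromatic polynomials. -/
noncomputable def absLin (P : Finset V → ℝ[X]) : SetFun V := -twist (linFun P)

/-- The chromatic polynomials at `-y`, up to sign. -/
noncomputable def absEval (P : Finset V → ℝ[X]) (y : ℝ) : SetFun V := twist (evalFun P (-y))

theorem SimpleGraph.indepFun_apply_of_not_disjoint {G : SimpleGraph V} {v : V} {K A : Finset V}
    (hv : ∀ u ∈ K, G.Adj u v) (hvA : v ∈ A) (h : G.indepFun A ≠ 0) : Disjoint K A := by
  have hA : G.IsIndepSet (A : Set V) := by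
    by_contra hA
    exact h (if_neg hA)
  refine Finset.disjoint_left.2 fun u hu huA => ?_
  exact hA huA hvA (hv u hu).ne (hv u hu)

theorem SimpleGraph.indepFun_empty (G : SimpleGraph V) : G.indepFun ∅ = 1 :=
  if_pos (by simp [SimpleGraph.IsIndepSet])

theorem mark_absLin [DecidableEq V] (K : Finset V) (P : Finset V → ℝ[X]) :
    mark K (absLin P) = -twist (mark K (linFun P)) := by
  ext S
  simp only [mark_apply, absLin, twist_apply, SetFun.neg_apply]
  split_ifs <;> simp

namespace IsColPoly

variable [DecidableEq V] {G : SimpleGraph V} {P : Finset V → ℝ[X]}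

theorem mark_insert_linFun_of (h : IsColPoly G P) {K : Finset V} {v : V}
    (hv : ∀ u ∈ K, G.Adj u v)
    (hK : mark K (evalFun P (-1)) = (-(K.card : ℝ)) • (mark K (linFun P) * evalFun P (-1))) :
    mark (insert v K) (linFun P) =
      (-(K.card : ℝ)) • (mark {v} (linFun P) * mark K (linFun P)) := by
  have h1 : mark (insert v K) (linFun P) = mark K (mark {v} (linFun P)) := by
    ext S
    simp only [mark_apply, Finset.insert_subset_iff, Finset.singleton_subset_iff]
    split_ifs <;> simp_all
  rw [h1, h.mark_linFun, mark_mul_of_disjoint, hK, mul_smul_comm]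
  · congr 1; ring
  · intro A hA
    rw [mark_apply] at hA
    split_ifs at hA with hvA
    · exact SimpleGraph.indepFun_apply_of_not_disjoint hv (by simpa using hvA) hA
    · exact absurd rfl hA

theorem mark_evalFun_clique (h : IsColPoly G P) {K : Finset V} (hne : K.Nonempty)
    (hK : G.IsClique (K : Set V)) :
    mark K (evalFun P (-1)) = (-(K.card : ℝ)) • (mark K (linFun P) * evalFun P (-1)) := by
  induction hne using Finset.Nonempty.cons_induction with
  | singleton v => simpa using h.mark_evalFun v (-1)
  | cons v K hv hne ih =>
    rw [Finset.cons_eq_insert] at hK ⊢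
    rw [Finset.coe_insert, SimpleGraph.isClique_insert_of_notMem (by simpa using hv)] at hK
    have ih := ih hK.1
    have h1 := h.mark_insert_linFun_of (v := v) (fun u hu => (hK.2 u hu).symm) ih
    have hc : (K.card : ℝ) ≠ 0 := by exact_mod_cast hne.card_pos.ne'
    have h2 : mark K (linFun P) * mark {v} (linFun P) =
        (-(K.card : ℝ)⁻¹) • mark (insert v K) (linFun P) := by
      rw [h1, smul_smul, neg_mul_neg, inv_mul_cancel₀ hc, one_smul, mul_comm]
    rw [← mark_mark, ih, mark_smul, mark_singleton_mul, mark_mark, h.mark_evalFun v (-1),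
      mul_smul_comm, ← mul_assoc, h2, Finset.card_insert_of_notMem hv, smul_mul_assoc]
    match_scalars
    field_simp

theorem mark_insert_absLin (h : IsColPoly G P) {K : Finset V} {v : V} (hne : K.Nonempty)
    (hK : G.IsClique (K : Set V)) (hv : ∀ u ∈ K, G.Adj u v) :
    mark (insert v K) (absLin P) = (K.card : ℝ) • (mark {v} (absLin P) * mark K (absLin P)) := by
  have h1 := congr_arg twist (h.mark_insert_linFun_of hv (h.mark_evalFun_clique hne hK))
  rw [mark_absLin, mark_absLin, mark_absLin, neg_mul_neg, h1, twist_smul, twist_mul, neg_smul, neg_neg]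

theorem mark_absEval (h : IsColPoly G P) (v : V) (y : ℝ) :
    mark {v} (absEval P y) = y • (mark {v} (absLin P) * absEval P y) := by
  rw [absEval, mark_twist, h.mark_evalFun, mark_absLin, twist_smul, twist_mul, neg_smul, neg_mul, smul_neg]

theorem derivative_eval_neg (h : IsColPoly G P) (S : Finset V) (y : ℝ) :
    (derivative (P S)).eval (-y) = -(-1) ^ S.card * (absLin P * absEval P y) S := by
  rw [h.derivative_eval, absLin, absEval, neg_mul (twist _), ← twist_mul, SetFun.neg_apply, twist_apply,
    neg_mul_neg, ← mul_assoc, ← pow_add, Even.neg_one_pow ⟨_, rfl⟩, one_mul]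

theorem absLin_empty (h : IsColPoly G P) : absLin P ∅ = 0 := by
  have : P ∅ = 1 := Polynomial.ext_eval_nat fun k => by
    rw [h, one_pow_apply_empty _ G.indepFun_empty, eval_one]
  simp [absLin, twist_apply, linFun_apply, this]

theorem evalFun_empty (h : IsColPoly G P) (x : ℝ) : evalFun P x ∅ = 1 := by
  have : P ∅ = 1 := Polynomial.ext_eval_nat fun k => by
    rw [h, one_pow_apply_empty _ G.indepFun_empty, eval_one]
  simp [evalFun_apply, this]

theorem absEval_empty (h : IsColPoly G P) (y : ℝ) : absEval P y ∅ = 1 := by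
  simp [absEval, twist_apply, h.evalFun_empty]

/-- If `v` has no neighbors in `D`, the linear coefficient vanishes unless `D = {v}`. -/
theorem absLin_of_isolated (h : IsColPoly G P) {D : Finset V} {v : V} (hv : v ∈ D)
    (hD : ∀ u ∈ D, ¬ G.Adj v u) : absLin P D = if D = {v} then 1 else 0 := by
  obtain ⟨E, hvE, rfl⟩ : ∃ E, v ∉ E ∧ insert v E = D :=
    ⟨D.erase v, Finset.notMem_erase v D, Finset.insert_erase hv⟩
  have h1 : linFun P (insert v E) = (G.indepFun * evalFun P (-1)) E := by
    have h2 := congr_fun (h.mark_linFun v) (insert v E)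
    rw [mark_apply, if_pos (by simp), mul_apply, Finset.sum_powerset_insert hvE,
      Finset.sum_eq_zero, zero_add] at h2
    · rw [h2, mul_apply]
      refine Finset.sum_congr rfl fun A hA => ?_
      have hA := Finset.mem_powerset.1 hA
      have h4 : G.indepFun (insert v A) = G.indepFun A := by
        unfold SimpleGraph.indepFun
        congr 1
        simp only [SimpleGraph.IsIndepSet, Finset.coe_insert, eq_iff_iff]
        rw [Set.pairwise_insert]
        refine and_iff_left fun u hu _ => ?_
        have := hD u (Finset.mem_insert_of_mem (hA hu))
        exact ⟨this, fun h => this h.symm⟩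
      rw [mark_apply, if_pos (by simp), h4, Finset.insert_sdiff_insert,
        Finset.sdiff_insert_of_notMem hvE]
    · intro A hA
      have : v ∉ A := fun hvA => hvE (Finset.mem_powerset.1 hA hvA)
      simp [mark_apply, this]
  rw [absLin, SetFun.neg_apply, twist_apply, h1]
  nth_rw 1 [← h.evalFun_one]
  rw [← h.evalFun_add, add_neg_cancel, h.evalFun_zero, one_apply]
  rcases E.eq_empty_or_nonempty with rfl | hE
  · simp
  · have : insert v E ≠ {v} := fun he => by
      obtain ⟨u, hu⟩ := hE
      have : u ∈ ({v} : Finset V) := he ▸ Finset.mem_insert_of_mem hu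
      exact hvE (Finset.mem_singleton.1 this ▸ hu)
    simp [this, hE.ne_empty]

theorem absLin_singleton (h : IsColPoly G P) (v : V) : absLin P {v} = 1 := by
  rw [h.absLin_of_isolated (v := v) (by simp) (by simp)]; simp

theorem absLin_nonneg (h : IsColPoly G P) (D : Finset V) : 0 ≤ absLin P D := by
  induction D using Finset.strongInduction with
  | H D ih =>
    rcases D.eq_empty_or_nonempty with rfl | ⟨v, hv⟩
    · rw [h.absLin_empty]
    · by_cases hD : ∀ u ∈ D, ¬ G.Adj v u
      · rw [h.absLin_of_isolated hv hD]; split_ifs <;> norm_num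
      · push Not at hD
        obtain ⟨u, hu, huv⟩ := hD
        have h1 := congr_fun (h.mark_insert_absLin (K := {u}) (v := v) (by simp) (by simp)
          (by simpa using huv.symm)) D
        rw [mark_apply, if_pos (by simp [Finset.insert_subset_iff, hu, hv]), smul_apply,
          mul_apply] at h1
        rw [h1]
        refine mul_nonneg (by positivity) (Finset.sum_nonneg fun A hA => ?_)
        rw [mark_apply, mark_apply]
        split_ifs with h2 h3
        · rw [Finset.singleton_subset_iff] at h2 h3
          rw [Finset.mem_sdiff] at h3
          refine mul_nonneg (ih A ?_) (ih _ (Finset.sdiff_ssubset (Finset.mem_powerset.1 hA) ⟨v, h2⟩))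
          exact Finset.ssubset_iff_subset_ne.2
            ⟨Finset.mem_powerset.1 hA, fun h => h3.2 (h ▸ h3.1)⟩
        all_goals simp

theorem absLin_pair (h : IsColPoly G P) {u v : V} (huv : G.Adj u v) : absLin P {v, u} = 1 := by
  have hne : u ≠ v := huv.ne
  have h1 := congr_fun (h.mark_insert_absLin (K := {u}) (v := v) (by simp) (by simp)
    (by simpa using huv)) {v, u}
  rw [mark_apply, if_pos le_rfl, smul_apply, mul_apply, Finset.sum_eq_single {v}] at h1
  · have : ({v, u} : Finset V) \ {v} = {u} := by
      ext w; simp; grind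
    simpa [mark_apply, this, h.absLin_singleton] using h1
  · intro A hA hAv
    rw [mark_apply, mark_apply]
    split_ifs with h2 h3
    · exfalso
      apply hAv
      rw [Finset.singleton_subset_iff] at h2 h3
      have := Finset.mem_powerset.1 hA
      grind
    all_goals simp
  · simp

theorem absEval_pos (h : IsColPoly G P) {y : ℝ} (hy : 0 < y) (S : Finset V) :
    0 < absEval P y S := by
  induction S using Finset.strongInduction with
  | H S ih =>
    rcases S.eq_empty_or_nonempty with rfl | ⟨v, hv⟩
    · rw [h.absEval_empty]; norm_num
    · have h1 := congr_fun (h.mark_absEval v y) S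
      rw [mark_apply, if_pos (by simpa using hv), smul_apply, mul_apply] at h1
      rw [h1]
      refine mul_pos hy (Finset.sum_pos' (fun A hA => ?_) ⟨{v}, by simpa using hv, ?_⟩)
      · rw [mark_apply]
        split_ifs with h2
        · refine mul_nonneg (h.absLin_nonneg A)
            (ih _ (Finset.sdiff_ssubset (Finset.mem_powerset.1 hA) ⟨v, by simpa using h2⟩)).le
        · simp
      · rw [mark_apply, if_pos le_rfl, h.absLin_singleton, one_mul]
        exact ih _ (Finset.sdiff_ssubset (by simpa using hv) (by simp))

end IsColPoly

end Indep

section Comparison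

open SetFun

variable {V : Type*}

open Classical in
/-- The restriction of `f` to the sets whose `r`-least element is `v`. -/
noncomputable def SetFun.lead (r : V → ℕ) (v : V) (f : SetFun V) : SetFun V :=
  fun S => if v ∈ S ∧ ∀ u ∈ S, r v ≤ r u then f S else 0

theorem SetFun.lead_apply_of_lt {r : V → ℕ} {u v : V} {S : Finset V} (hu : u ∈ S)
    (huv : r u < r v) (f : SetFun V) : lead r v f S = 0 :=
  if_neg fun h => huv.not_ge (h.2 u hu)

theorem SetFun.lead_apply_of_notMem {r : V → ℕ} {v : V} {S : Finset V} (hv : v ∉ S)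
    (f : SetFun V) : lead r v f S = 0 :=
  if_neg fun h => hv h.1

theorem SetFun.lead_le_mark [DecidableEq V] {f : SetFun V} (hf : ∀ S, 0 ≤ f S) (r : V → ℕ) (v : V)
    (S : Finset V) : lead r v f S ≤ mark {v} f S := by
  unfold lead
  rw [mark_apply]
  split_ifs with h1 h2 h2
  exacts [le_rfl, absurd (Finset.singleton_subset_iff.2 h1.1) h2, hf S, le_rfl]

theorem SetFun.mark_nonneg [DecidableEq V] {f : SetFun V} (hf : ∀ S, 0 ≤ f S) (K S : Finset V) :
    0 ≤ mark K f S := by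
  rw [mark_apply]
  split_ifs
  exacts [hf S, le_rfl]

theorem SetFun.sum_lead [Fintype V] {r : V → ℕ} (hr : r.Injective) (f : SetFun V) (hf : f ∅ = 0) :
    ∑ v, lead r v f = f := by
  ext S
  rw [sum_apply]
  rcases S.eq_empty_or_nonempty with rfl | hS
  · simp [lead, hf]
  · obtain ⟨v, hv, hmin⟩ := S.exists_min_image r hS
    rw [Finset.sum_eq_single v]
    · exact if_pos ⟨hv, hmin⟩
    · intro u _ huv
      refine if_neg fun h => huv (hr (le_antisymm (h.2 v hv) (hmin u h.1)))
    · simp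

namespace IsColPoly

variable [DecidableEq V] {G : SimpleGraph V} {P : Finset V → ℝ[X]}

theorem sum_mark_mul_lead_le (h : IsColPoly G P) {r : V → ℕ} {v : V} {K : Finset V}
    (hlt : ∀ u ∈ K, r u < r v) (hK : G.IsClique (K : Set V)) (hv : ∀ u ∈ K, G.Adj u v)
    (D : Finset V) :
    ((∑ u ∈ K, mark {u} (absLin P)) * lead r v (absLin P)) D ≤
      mark {v} (absLin P) D - lead r v (absLin P) D := by
  have ha := h.absLin_nonneg
  rw [Finset.sum_mul, SetFun.sum_apply]
  by_cases hvD : v ∈ D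
  swap
  · have h1 : mark {v} (absLin P) D = 0 := if_neg (by simpa using hvD)
    rw [h1, lead_apply_of_notMem hvD, sub_zero]
    refine (Finset.sum_eq_zero fun u _ => Finset.sum_eq_zero fun A _ => ?_).le
    rw [lead_apply_of_notMem (fun h => hvD (Finset.mem_sdiff.1 h).1), mul_zero]
  · rcases (K ∩ D).eq_empty_or_nonempty with hT | hT
    · rw [Finset.sum_eq_zero]
      · exact sub_nonneg.2 (lead_le_mark ha r v D)
      · intro u hu
        refine mark_singleton_mul_apply_of_notMem (fun huD => ?_) _ _
        exact Finset.notMem_empty u (hT ▸ Finset.mem_inter.2 ⟨hu, huD⟩)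
    · have h1 : lead r v (absLin P) D = 0 := by
        obtain ⟨u, hu⟩ := hT
        rw [Finset.mem_inter] at hu
        exact lead_apply_of_lt hu.2 (hlt u hu.1) _
      have h2 := congr_fun (h.mark_insert_absLin (K := K ∩ D) (v := v) hT
        (hK.subset (by simp)) (fun u hu => hv u (Finset.mem_inter.1 hu).1)) D
      rw [mark_apply, if_pos (Finset.insert_subset hvD Finset.inter_subset_right), smul_apply]
        at h2
      rw [h1, sub_zero, mark_apply, if_pos (by simpa using hvD), h2, ← nsmul_eq_mul,
        ← Finset.sum_const, ← Finset.sum_subset Finset.inter_subset_left]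
      · refine Finset.sum_le_sum fun u hu => ?_
        rw [mul_comm (mark {v} _)]
        refine Finset.sum_le_sum fun A hA => ?_
        by_cases hKA : Disjoint K (D \ A)
        · have hA' : K ∩ D ⊆ A := fun w hw => by
            by_contra hwA
            rw [Finset.mem_inter] at hw
            exact Finset.disjoint_left.1 hKA hw.1 (Finset.mem_sdiff.2 ⟨hw.2, hwA⟩)
          have h3 : mark (K ∩ D) (absLin P) A = absLin P A := if_pos hA'
          have h4 : mark {u} (absLin P) A = absLin P A := if_pos (by simpa using hA' hu)
          rw [h3, h4]
          exact mul_le_mul_of_nonneg_left (lead_le_mark ha r v _) (ha A)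
        · rw [Finset.not_disjoint_iff] at hKA
          obtain ⟨w, hwK, hw⟩ := hKA
          rw [lead_apply_of_lt hw (hlt w hwK), mul_zero]
          exact mul_nonneg (mark_nonneg ha _ _) (mark_nonneg ha _ _)
      · intro u hu huD
        refine mark_singleton_mul_apply_of_notMem (fun h => huD ?_) _ _
        exact Finset.mem_inter.2 ⟨hu, h⟩

theorem absEval_univ_eq [Fintype V] (h : IsColPoly G P) {r : V → ℕ} {v : V} {K : Finset V}
    (hlt : ∀ u ∈ K, r u < r v) (y : ℝ) :
    absEval P y Finset.univ =
      (y + K.card) * (lead r v (absLin P) * absEval P y) Finset.univ +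
      y * ((mark {v} (absLin P) - lead r v (absLin P) -
        (∑ u ∈ K, mark {u} (absLin P)) * lead r v (absLin P)) * absEval P y) Finset.univ := by
  set a := absLin P
  set q := absEval P y
  set m := lead r v a
  have h1 : ∀ (u : V) (g : SetFun V), mark {u} g Finset.univ = g Finset.univ :=
    fun u g => if_pos (by simp)
  have h2 : ∀ u ∈ K, y * ((mark {u} a * m) * q) Finset.univ = (m * q) Finset.univ := by
    intro u hu
    rw [← h1 u (m * q), mark_mul_of_disjoint, h.mark_absEval u y, ← smul_apply, mul_smul_comm]
    · rw [mul_right_comm, mul_comm m, mul_right_comm]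
    · intro A hA
      rw [Finset.disjoint_singleton_left]
      exact fun huA => hA (lead_apply_of_lt huA (hlt u hu) _)
  have h3 : y * (((∑ u ∈ K, mark {u} a) * m) * q) Finset.univ =
      K.card * (m * q) Finset.univ := by
    rw [Finset.sum_mul, Finset.sum_mul, SetFun.sum_apply, Finset.mul_sum, Finset.sum_congr rfl h2,
      Finset.sum_const, nsmul_eq_mul]
  have h4 : q Finset.univ = y * (mark {v} a * q) Finset.univ := by
    rw [← h1 v q, h.mark_absEval v y]; rfl
  rw [sub_mul, sub_mul, SetFun.sub_apply, SetFun.sub_apply, mul_sub, mul_sub, h3, h4]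
  ring

theorem lead_mul_le [Fintype V] (h : IsColPoly G P) {r : V → ℕ} {v : V} {K : Finset V}
    (hlt : ∀ u ∈ K, r u < r v) (hK : G.IsClique (K : Set V)) (hv : ∀ u ∈ K, G.Adj u v)
    {y : ℝ} (hy : 0 < y) :
    (lead r v (absLin P) * absEval P y) Finset.univ ≤ absEval P y Finset.univ * (y + K.card)⁻¹ := by
  rw [← div_eq_mul_inv, le_div_iff₀ (by positivity), mul_comm, h.absEval_univ_eq hlt y]
  refine le_add_of_nonneg_right (mul_nonneg hy.le (Finset.sum_nonneg fun D _ => ?_))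
  refine mul_nonneg ?_ (h.absEval_pos hy _).le
  exact sub_nonneg.2 (h.sum_mark_mul_lead_le hlt hK hv D)

theorem lead_mul_lt [Fintype V] (h : IsColPoly G P) {r : V → ℕ} {v w : V} {K : Finset V}
    (hlt : ∀ u ∈ K, r u < r v) (hK : G.IsClique (K : Set V)) (hv : ∀ u ∈ K, G.Adj u v)
    (hwK : w ∉ K) (hw : G.Adj w v) (hwv : r w < r v) {y : ℝ} (hy : 0 < y) :
    (lead r v (absLin P) * absEval P y) Finset.univ < absEval P y Finset.univ * (y + K.card)⁻¹ := by
  rw [← div_eq_mul_inv, lt_div_iff₀ (by positivity), mul_comm, h.absEval_univ_eq hlt y]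
  refine lt_add_of_pos_right _ (mul_pos hy (Finset.sum_pos' (fun D _ => ?_)
    ⟨{v, w}, by simp, mul_pos ?_ (h.absEval_pos hy _)⟩))
  · refine mul_nonneg ?_ (h.absEval_pos hy _).le
    exact sub_nonneg.2 (h.sum_mark_mul_lead_le hlt hK hv D)
  · have h1 : mark {v} (absLin P) {v, w} = 1 := by
      rw [mark_apply, if_pos (by simp), h.absLin_pair hw]
    rw [SetFun.sub_apply, SetFun.sub_apply, h1, lead_apply_of_lt (by simp) hwv, Finset.sum_mul,
      SetFun.sum_apply, Finset.sum_eq_zero]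
    · norm_num
    · intro u hu
      refine mark_singleton_mul_apply_of_notMem (fun huD => ?_) _ _
      rw [Finset.mem_insert, Finset.mem_singleton] at huD
      rcases huD with rfl | rfl
      · exact (hlt _ hu).false
      · exact hwK hu

/-- The logarithmic derivative of the chromatic polynomial at a negative number, compared with
the sum determined by back-cliques of an ordering of the vertices. -/
theorem absLin_mul_absEval_lt [Fintype V] (h : IsColPoly G P) {r : V → ℕ} (hr : r.Injective)
    {K : V → Finset V} (hlt : ∀ v, ∀ u ∈ K v, r u < r v) (hK : ∀ v, G.IsClique (K v : Set V))
    (hv : ∀ v, ∀ u ∈ K v, G.Adj u v) {v w : V} (hwK : w ∉ K v) (hw : G.Adj w v) (hwv : r w < r v)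
    {y : ℝ} (hy : 0 < y) :
    (absLin P * absEval P y) Finset.univ <
      absEval P y Finset.univ * ∑ v, (y + (K v).card)⁻¹ := by
  nth_rw 1 [← sum_lead hr (absLin P) h.absLin_empty]
  rw [Finset.sum_mul, SetFun.sum_apply, Finset.mul_sum]
  exact Finset.sum_lt_sum (fun v _ => h.lead_mul_le (hlt v) (hK v) (hv v) hy)
    ⟨v, Finset.mem_univ v, h.lead_mul_lt (hlt v) (hK v) (hv v) hwK hw hwv hy⟩

theorem pow_insert (v : V) (k : ℕ) (S : Finset V) (hv : v ∉ S) (N : Finset V)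
    (hNS : ∀ u, u ∈ N ↔ u ∈ S ∧ G.Adj v u) (hN : G.IsClique (N : Set V)) :
    (G.indepFun ^ k) (insert v S) = (k - N.card) * (G.indepFun ^ k) S := by
  induction k generalizing S N with
  | zero =>
    rcases S.eq_empty_or_nonempty with rfl | hS
    · have : N = ∅ := Finset.eq_empty_of_forall_notMem fun u hu => by simpa using (hNS u).1 hu
      simp [one_apply, this]
    · simp [one_apply, hS.ne_empty]
  | succ k ih =>
    rw [pow_succ', mul_apply, mul_apply, Finset.sum_powerset_insert hv, ← Finset.sum_add_distrib,
      Finset.mul_sum]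
    refine Finset.sum_congr rfl fun A hA => ?_
    have hA := Finset.mem_powerset.1 hA
    have hvA : v ∉ A := fun h => hv (hA h)
    rw [Finset.insert_sdiff_of_notMem _ hvA, Finset.insert_sdiff_insert,
      Finset.sdiff_insert_of_notMem hv,
      ih (S \ A) (by simp [hv]) (N \ A) (by intro u; simp [hNS]; tauto)
        (hN.subset (by simp))]
    by_cases hAi : G.IsIndepSet (A : Set V)
    swap
    · have h1 : G.indepFun A = 0 := if_neg hAi
      have h2 : G.indepFun (insert v A) = 0 := if_neg fun h => hAi (h.mono (by simp))
      simp [h1, h2]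
    have h1 : G.indepFun A = 1 := if_pos hAi
    have h2 : ((N \ A).card : ℝ) + (N ∩ A).card = N.card := by
      exact_mod_cast Finset.card_sdiff_add_card_inter N A
    rcases (N ∩ A).eq_empty_or_nonempty with hNA | ⟨u, hu⟩
    · have h3 : G.indepFun (insert v A) = 1 := by
        refine if_pos ?_
        rw [SimpleGraph.IsIndepSet, Finset.coe_insert, Set.pairwise_insert]
        refine ⟨hAi, fun u hu _ => ?_⟩
        have : ¬ G.Adj v u := fun huv => Finset.notMem_empty u <|
          hNA ▸ Finset.mem_inter.2 ⟨(hNS u).2 ⟨hA hu, huv⟩, hu⟩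
        exact ⟨this, fun h => this h.symm⟩
      rw [h1, h3, ← h2, hNA]
      push_cast
      simp
      ring
    · have h4 : N ∩ A = {u} := by
        refine Finset.eq_singleton_iff_unique_mem.2 ⟨hu, fun w hw => ?_⟩
        rw [Finset.mem_inter] at hu hw
        by_contra hne
        exact hAi hw.2 hu.2 hne (hN hw.1 hu.1 hne)
      have h3 : G.indepFun (insert v A) = 0 := by
        rw [Finset.mem_inter] at hu
        exact if_neg fun h => h (by simp) (by simp [hu.2]) ((hNS u).1 hu.1).2.ne
          ((hNS u).1 hu.1).2
      rw [h1, h3, ← h2, h4]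
      push_cast
      simp

theorem eq_prod (h : IsColPoly G P) {r : V → ℕ} (hr : r.Injective) {K : V → Finset V}
    (hKr : ∀ u v, u ∈ K v ↔ r u < r v ∧ G.Adj v u) (hK : ∀ v, G.IsClique (K v : Set V))
    (S : Finset V) (hS : ∀ v ∈ S, K v ⊆ S) : P S = ∏ v ∈ S, (X - C ((K v).card : ℝ)) := by
  induction S using Finset.induction_on_max_value r with
  | empty =>
    refine Polynomial.ext_eval_nat fun k => ?_
    rw [h, one_pow_apply_empty _ G.indepFun_empty]; simp
  | insert v S hv hmax ih =>
    rw [Finset.prod_insert hv, ← ih]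
    · refine Polynomial.ext_eval_nat fun k => ?_
      rw [h, eval_mul, h, pow_insert v k S hv (K v) _ (hK v)]
      · simp
      · intro u
        rw [hKr]
        refine ⟨fun hu => ⟨?_, hu.2⟩, fun hu => ⟨lt_of_le_of_ne (hmax u hu.1) fun he => ?_, hu.2⟩⟩
        · exact (Finset.mem_insert.1 (hS v (by simp) ((hKr u v).2 hu))).resolve_left hu.2.ne'
        · exact hu.2.ne' (hr he)
    · intro w hw u hu
      refine (Finset.mem_insert.1 (hS w (by simp [hw]) hu)).resolve_left ?_
      rintro rfl
      exact absurd (hmax w hw) (not_le.2 ((hKr _ _).1 hu).1)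

end IsColPoly

end Comparison

section Coloring

variable {V : Type*} [Fintype V] [DecidableEq V]

open Classical in
/-- Proper colorings of `G[S]` with colors `1, …, k`, extended by `0` outside `S`. -/
noncomputable def SimpleGraph.coloringsOn (G : SimpleGraph V) (S : Finset V) (k : ℕ) :
    Finset (V → ℕ) :=
  {c ∈ Fintype.piFinset fun v => if v ∈ S then Finset.Icc 1 k else {0} |
    ∀ u ∈ S, ∀ v ∈ S, G.Adj u v → c u ≠ c v}

theorem SimpleGraph.mem_coloringsOn {G : SimpleGraph V} {S : Finset V} {k : ℕ} {c : V → ℕ} :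
    c ∈ G.coloringsOn S k ↔ (∀ v ∈ S, 1 ≤ c v ∧ c v ≤ k) ∧ (∀ v, v ∉ S → c v = 0) ∧
      ∀ u ∈ S, ∀ v ∈ S, G.Adj u v → c u ≠ c v := by
  classical
  unfold coloringsOn
  rw [Finset.mem_filter, Fintype.mem_piFinset, ← and_assoc]
  refine and_congr_left fun _ => ?_
  constructor
  · intro h
    exact ⟨fun v hv => by simpa [hv] using h v, fun v hv => by simpa [hv] using h v⟩
  · rintro ⟨h1, h2⟩ v
    by_cases hv : v ∈ S
    · simpa [hv] using h1 v hv
    · simpa [hv] using h2 v hv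

theorem SimpleGraph.card_coloringsOn (G : SimpleGraph V) (S : Finset V) (k : ℕ) :
    ((G.coloringsOn S k).card : ℝ) = (G.indepFun ^ k) S := by
  classical
  induction k generalizing S with
  | zero =>
    rw [pow_zero, SetFun.one_apply]
    split_ifs with hS
    · subst hS
      have : G.coloringsOn ∅ 0 = {fun _ => 0} := by
        ext c
        simp [mem_coloringsOn, funext_iff]
      simp [this]
    · obtain ⟨v, hv⟩ := Finset.nonempty_iff_ne_empty.2 hS
      have : G.coloringsOn S 0 = ∅ := Finset.eq_empty_of_forall_notMem fun c hc => by
        have := (mem_coloringsOn.1 hc).1 v hv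
        omega
      simp [this]
  | succ k ih =>
    rw [Finset.card_eq_sum_card_fiberwise (f := fun c => S.filter (c · = k + 1)) (t := S.powerset)
      (fun c _ => Finset.mem_coe.2 (Finset.mem_powerset.2 (Finset.filter_subset _ _))), pow_succ', SetFun.mul_apply, Nat.cast_sum]
    refine Finset.sum_congr rfl fun A hA => ?_
    have hA := Finset.mem_powerset.1 hA
    by_cases hAi : G.IsIndepSet (A : Set V)
    · have h1 : G.indepFun A = 1 := if_pos hAi
      rw [h1, one_mul, ← ih, Nat.cast_inj]
      refine Finset.card_nbij' (fun c v => if v ∈ A then 0 else c v)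
        (fun c v => if v ∈ A then k + 1 else c v) ?_ ?_ ?_ ?_
      · intro c hc
        rw [Finset.mem_coe, Finset.mem_filter, mem_coloringsOn] at hc
        rw [Finset.mem_coe, mem_coloringsOn]
        obtain ⟨⟨hc1, hc2, hc3⟩, rfl⟩ := hc
        refine ⟨fun v hv => ?_, fun v hv => ?_, fun u hu v hv huv => ?_⟩
        · have := hc1 v
          grind
        · grind
        · have := hc3 u (by grind) v (by grind) huv
          grind
      · intro c hc
        rw [Finset.mem_coe, mem_coloringsOn] at hc
        rw [Finset.mem_coe, Finset.mem_filter, mem_coloringsOn]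
        obtain ⟨h1, h2, h3⟩ := hc
        refine ⟨⟨fun v hv => ?_, fun v hv => ?_, fun u hu v hv huv => ?_⟩, ?_⟩
        · have := h1 v
          grind
        · grind
        · have h4 : u ∈ A → v ∈ A → False := fun hu hv => hAi hu hv huv.ne huv
          have := h3 u
          have h5 := h1 u
          have h6 := h1 v
          grind
        · ext v
          have h6 := h1 v
          grind
      · intro c hc
        rw [Finset.mem_coe, Finset.mem_filter, mem_coloringsOn] at hc
        obtain ⟨-, rfl⟩ := hc
        funext v
        grind
      · intro c hc
        rw [Finset.mem_coe, mem_coloringsOn] at hc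
        funext v
        have := hc.2.1 v
        grind
    · have h1 : G.indepFun A = 0 := if_neg hAi
      rw [h1, zero_mul, Nat.cast_eq_zero, Finset.card_eq_zero]
      refine Finset.eq_empty_of_forall_notMem fun c hc => hAi ?_
      rw [Finset.mem_filter, mem_coloringsOn] at hc
      obtain ⟨⟨-, -, h3⟩, rfl⟩ := hc
      intro u hu v hv _ huv
      rw [Finset.mem_coe, Finset.mem_filter] at hu hv
      exact h3 u hu.1 v hv.1 huv (hu.2.trans hv.2.symm)

theorem SimpleGraph.card_coloring (G : SimpleGraph V) (k : ℕ) :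
    (Nat.card (G.Coloring (Fin k)) : ℝ) = (G.indepFun ^ k) Finset.univ := by
  rw [← G.card_coloringsOn, Nat.cast_inj, ← Nat.card_eq_finsetCard]
  refine Nat.card_congr
    { toFun := fun C => ⟨fun v => C v + 1, ?_⟩
      invFun := fun c => Coloring.mk (fun v => ⟨c.1 v - 1, ?_⟩) ?_
      left_inv := ?_
      right_inv := ?_ }
  · rw [mem_coloringsOn]
    refine ⟨fun v _ => ⟨by omega, (C v).2⟩, by simp, fun u _ v _ huv h => C.valid huv ?_⟩
    exact Fin.ext (by omega)
  · have := (mem_coloringsOn.1 c.2).1 v (Finset.mem_univ v)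
    omega
  · intro u v huv h
    have hc := mem_coloringsOn.1 c.2
    have h1 := hc.1 u (Finset.mem_univ u)
    have h2 := hc.1 v (Finset.mem_univ v)
    have h3 := hc.2.2 u (Finset.mem_univ u) v (Finset.mem_univ v) huv
    rw [Fin.mk.injEq] at h
    omega
  · intro C
    ext v
    exact Nat.add_sub_cancel (C v : ℕ) 1
  · intro c
    ext v
    have h1 := (mem_coloringsOn.1 c.2).1 v (Finset.mem_univ v)
    change c.1 v - 1 + 1 = c.1 v
    omega

end Coloring

section Chordal

variable {V : Type*}

namespace SimpleGraph

/-- The graph on the same vertices keeping only the edges with both ends in `T`. -/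
def within (G : SimpleGraph V) (T : Set V) : SimpleGraph V where
  Adj a b := G.Adj a b ∧ a ∈ T ∧ b ∈ T
  symm := ⟨fun _ _ h => ⟨h.1.symm, h.2.2, h.2.1⟩⟩
  loopless := ⟨fun _ h => h.1.ne rfl⟩

theorem within_le (G : SimpleGraph V) (T : Set V) : G.within T ≤ G := fun _ _ h => h.1

theorem Walk.isChordless_of_length_eq_dist {G : SimpleGraph V} {x y : V} (p : G.Walk x y)
    (hp : p.length = G.dist x y) : p.IsChordless := by
  have key : ∀ i j, i < j → j ≤ p.length → G.Adj (p.getVert i) (p.getVert j) →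
      s(p.getVert i, p.getVert j) ∈ p.edges := by
    intro i j hij hj hadj
    have h1 := G.dist_le ((p.take i).append (Walk.cons hadj (p.drop j)))
    rw [length_append, length_cons, take_length, drop_length, ← hp] at h1
    have h2 : j = i + 1 := by omega
    subst h2
    exact p.mk_mem_edges_iff_exists.2 ⟨i, by omega, rfl⟩
  rw [isChordless_iff_forall_mem_edges]
  intro a b ha hb hab
  rw [mem_support_iff_exists_getVert] at ha hb
  obtain ⟨i, rfl, hi⟩ := ha
  obtain ⟨j, rfl, hj⟩ := hb
  rcases lt_trichotomy i j with h | rfl | h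
  · exact key i j h hj hab
  · exact absurd rfl hab.ne
  · rw [Sym2.eq_swap]
    exact key j i h hi hab.symm

theorem exists_isChordless_of_reachable_within {G : SimpleGraph V} {T : Set V} {x y : V}
    (hx : x ∈ T) (h : (G.within T).Reachable x y) :
    ∃ p : G.Walk x y, p.IsPath ∧ p.IsChordless ∧ ∀ w ∈ p.support, w ∈ T := by
  obtain ⟨q, hq⟩ := h.exists_walk_length_eq_dist
  have hT : ∀ {a b : V} (q : (G.within T).Walk a b), a ∈ T → ∀ w ∈ q.support, w ∈ T := by
    intro a b q
    induction q with
    | nil => simp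
    | cons hab q ih =>
      intro ha w hw
      rw [Walk.support_cons, List.mem_cons] at hw
      rcases hw with rfl | hw
      exacts [ha, ih hab.2.2 w hw]
  refine ⟨q.mapLe (G.within_le T), (q.isPath_of_length_eq_dist hq).mapLe _, ?_, ?_⟩
  · rw [Walk.isChordless_iff_forall_mem_edges]
    intro a b ha hb hab
    rw [Walk.support_mapLe_eq_support] at ha hb
    rw [Walk.edges_mapLe_eq_edges]
    exact (q.isChordless_of_length_eq_dist hq).mem_edges ha hb
      ⟨hab, hT q hx a ha, hT q hx b hb⟩
  · intro w hw
    rw [Walk.support_mapLe_eq_support] at hw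
    exact hT q hx w hw

end SimpleGraph

namespace IsChordal

variable {Q : SimpleGraph V}

theorem adj_of_isChordless (hQ : IsChordal Q) {u x y : V} {p : Q.Walk x y} (hp : p.IsPath)
    (hc : p.IsChordless) (hxy : x ≠ y) (hu : u ∉ p.support) (hux : Q.Adj u x) (huy : Q.Adj u y)
    (hN : ∀ w ∈ p.support, Q.Adj u w → w = x ∨ w = y) : Q.Adj x y := by
  by_contra hadj
  have h0 : p.length ≠ 0 := fun h => hxy (SimpleGraph.Walk.eq_of_length_eq_zero h)
  have h1 : p.length ≠ 1 := fun h => hadj (SimpleGraph.Walk.adj_of_length_eq_one h)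
  let w := SimpleGraph.Walk.cons hux (p.concat huy.symm)
  have hw : w.IsCycle := by
    rw [SimpleGraph.Walk.cons_isCycle_iff]
    refine ⟨hp.concat hu huy.symm, ?_⟩
    rw [SimpleGraph.Walk.edges_concat, List.concat_eq_append, List.mem_append, List.mem_singleton,
      not_or]
    refine ⟨fun h => hu (p.fst_mem_support_of_mem_edges h), fun h => ?_⟩
    rw [Sym2.eq_swap, Sym2.eq_iff] at h
    rcases h with h | h
    exacts [hxy h.1, hux.ne h.1.symm]
  have hs : ∀ v, v ∈ w.support ↔ v = u ∨ v ∈ p.support := by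
    intro v
    simp [w, SimpleGraph.Walk.support_concat]
    tauto
  have he : ∀ e, e ∈ w.edges ↔ e = s(u, x) ∨ e ∈ p.edges ∨ e = s(y, u) := by
    intro e
    simp [w, SimpleGraph.Walk.edges_concat]
  obtain ⟨a, b, ha, hb, hab, hne⟩ := hQ u w hw (by simp [w]; omega)
  rw [hs] at ha hb
  rw [he, not_or, not_or] at hne
  have key : ∀ v ∈ p.support, Q.Adj u v → s(u, v) = s(u, x) ∨ s(u, v) = s(y, u) := by
    intro v hv huv
    rcases hN v hv huv with rfl | rfl
    exacts [Or.inl rfl, Or.inr Sym2.eq_swap]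
  rcases ha with rfl | ha <;> rcases hb with rfl | hb
  · exact hab.ne rfl
  · rcases key b hb hab with h | h
    exacts [hne.1 h, hne.2.2 h]
  · rw [Sym2.eq_swap] at hne
    rcases key a ha hab.symm with h | h
    exacts [hne.1 h, hne.2.2 h]
  · exact hne.2.1 (hc.mem_edges ha hb hab)

/-- In a chordal graph every clique strictly inside `S` misses a simplicial vertex of `S`. -/
theorem exists_simplicial (hQ : IsChordal Q) (S X : Finset V) (hX : X ⊂ S)
    (hXc : Q.IsClique (X : Set V)) :
    ∃ v ∈ S, v ∉ X ∧ Q.IsClique {w | w ∈ S ∧ Q.Adj v w} := by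
  classical
  induction S using Finset.strongInduction generalizing X with
  | H S ih =>
    by_cases hS : Q.IsClique (S : Set V)
    · obtain ⟨v, hv, hvX⟩ := Finset.exists_of_ssubset hX
      exact ⟨v, hv, hvX, hS.subset fun w hw => hw.1⟩
    obtain ⟨u, hu, huX, c₀, hc₀, hc₀u, hadj⟩ : ∃ u ∈ S, (∀ x ∈ X, x = u ∨ Q.Adj u x) ∧
        ∃ c ∈ S, c ≠ u ∧ ¬ Q.Adj u c := by
      by_cases h : ∃ u ∈ X, ∃ c ∈ S, c ≠ u ∧ ¬ Q.Adj u c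
      · obtain ⟨u, hu, h⟩ := h
        refine ⟨u, hX.1 hu, fun x hx => ?_, h⟩
        by_cases hxu : x = u
        exacts [Or.inl hxu, Or.inr (hXc hu hx (Ne.symm hxu))]
      · push Not at h
        rw [SimpleGraph.IsClique, Set.Pairwise] at hS
        push Not at hS
        obtain ⟨u, hu, c, hc, huc, hadj⟩ := hS
        refine ⟨u, hu, fun x hx => ?_, c, hc, huc.symm, hadj⟩
        by_cases hxu : x = u
        exacts [Or.inl hxu, Or.inr (h x hx u hu (Ne.symm hxu)).symm]
    let A : Set V := {a | a ∈ S ∧ a ≠ u ∧ ¬ Q.Adj u a}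
    let C : Finset V := S.filter fun c => (Q.within A).Reachable c₀ c
    let N : Finset V := S.filter fun x => x ∉ C ∧ ∃ c ∈ C, Q.Adj x c
    have hcC : c₀ ∈ C := Finset.mem_filter.2 ⟨hc₀, .refl _⟩
    have hCA : ∀ c ∈ C, c ∈ A := by
      intro c hc
      have h := (Finset.mem_filter.1 hc).2
      rw [SimpleGraph.reachable_iff_reflTransGen] at h
      rcases h.cases_tail with rfl | ⟨d, _, hd⟩
      exacts [⟨hc₀, hc₀u, hadj⟩, hd.2.2]
    have hstep : ∀ c ∈ C, ∀ d ∈ A, Q.Adj c d → d ∈ C := by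
      intro c hc d hd hcd
      refine Finset.mem_filter.2 ⟨hd.1, (Finset.mem_filter.1 hc).2.trans ?_⟩
      exact SimpleGraph.Adj.reachable ⟨hcd, hCA c hc, hd⟩
    have hNu : ∀ x ∈ N, Q.Adj u x := by
      intro x hx
      obtain ⟨hxS, hxC, c, hc, hxc⟩ := Finset.mem_filter.1 hx
      by_contra hux
      refine hxC (hstep c hc x ⟨hxS, ?_, hux⟩ hxc.symm)
      rintro rfl
      exact (hCA c hc).2.2 hxc
    have hNc : Q.IsClique (N : Set V) := by
      intro x hx y hy hxy
      obtain ⟨-, hxC, c, hc, hxc⟩ := Finset.mem_filter.1 hx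
      obtain ⟨-, hyC, d, hd, hyd⟩ := Finset.mem_filter.1 hy
      let T : Set V := {w | w ∈ C ∨ w = x ∨ w = y}
      have hreach : ∀ e ∈ C, (Q.within T).Reachable c₀ e := by
        intro e he
        have h := (Finset.mem_filter.1 he).2
        rw [SimpleGraph.reachable_iff_reflTransGen] at h
        clear he
        induction h with
        | refl => exact .refl _
        | @tail a b hab hb ih =>
          have ha : a ∈ C := Finset.mem_filter.2
            ⟨hb.2.1.1, (SimpleGraph.reachable_iff_reflTransGen _ _).2 hab⟩
          exact ih.trans (SimpleGraph.Adj.reachable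
            ⟨hb.1, Or.inl ha, Or.inl (hstep a ha b hb.2.2 hb.1)⟩)
      have hxT : x ∈ T := Or.inr (Or.inl rfl)
      have h1 : (Q.within T).Reachable x c :=
        SimpleGraph.Adj.reachable ⟨hxc, hxT, Or.inl hc⟩
      have h2 : (Q.within T).Reachable d y :=
        SimpleGraph.Adj.reachable ⟨hyd.symm, Or.inl hd, Or.inr (Or.inr rfl)⟩
      obtain ⟨p, hp, hpc, hpT⟩ := SimpleGraph.exists_isChordless_of_reachable_within hxT
        (h1.trans ((hreach c hc).symm.trans ((hreach d hd).trans h2)))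
      refine hQ.adj_of_isChordless hp hpc hxy (fun hup => ?_) (hNu x hx) (hNu y hy) ?_
      · rcases hpT u hup with h | h | h
        exacts [(hCA u h).2.1 rfl, (hNu x hx).ne h, (hNu y hy).ne h]
      · intro w hw huw
        exact (hpT w hw).resolve_left fun h => (hCA w h).2.2 huw
    have hsub : C ∪ N ⊆ S := Finset.union_subset (Finset.filter_subset _ _)
      (Finset.filter_subset _ _)
    have hssub : C ∪ N ⊂ S := by
      refine Finset.ssubset_iff_subset_ne.2 ⟨hsub, fun h => ?_⟩
      rw [← h, Finset.mem_union] at hu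
      rcases hu with hu | hu
      exacts [(hCA u hu).2.1 rfl, (hNu u hu).ne rfl]
    have hNss : N ⊂ C ∪ N := by
      refine Finset.ssubset_iff_subset_ne.2 ⟨Finset.subset_union_right, fun h => ?_⟩
      have : c₀ ∈ N := h ▸ Finset.mem_union_left _ hcC
      exact (Finset.mem_filter.1 this).2.1 hcC
    obtain ⟨v, hv, hvN, hvc⟩ := ih _ hssub N hNss hNc
    have hvC : v ∈ C := (Finset.mem_union.1 hv).resolve_right hvN
    refine ⟨v, hsub hv, fun hvX => ?_, hvc.subset ?_⟩
    · rcases huX v hvX with h | h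
      exacts [(hCA v hvC).2.1 h, (hCA v hvC).2.2 h]
    · intro w hw
      refine ⟨Finset.mem_union.2 ?_, hw.2⟩
      by_cases hwC : w ∈ C
      exacts [Or.inl hwC, Or.inr (Finset.mem_filter.2 ⟨hw.1, hwC, v, hvC, hw.2.symm⟩)]

/-- A finite chordal graph has an ordering in which the earlier neighbors of each vertex form
a clique. -/
theorem exists_elimination_ordering [Fintype V] (hQ : IsChordal Q) :
    ∃ r : V → ℕ, r.Injective ∧ ∀ v, Q.IsClique {u | r u < r v ∧ Q.Adj v u} := by
  classical
  have key : ∀ S : Finset V, ∃ r : V → ℕ, Set.InjOn r S ∧ (∀ v ∈ S, r v < S.card) ∧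
      ∀ v ∈ S, Q.IsClique {u | u ∈ S ∧ r u < r v ∧ Q.Adj v u} := by
    intro S
    induction S using Finset.strongInduction with
    | H S ih =>
      rcases S.eq_empty_or_nonempty with rfl | hS
      · exact ⟨fun _ => 0, by simp⟩
      · obtain ⟨v, hv, -, hvc⟩ := hQ.exists_simplicial S ∅ (Finset.empty_ssubset.2 hS) (by simp)
        obtain ⟨r, hr, hlt, hc⟩ := ih (S.erase v) (Finset.erase_ssubset hv)
        have hcard := Finset.card_erase_add_one hv
        have hne : ∀ w, w ≠ v → Function.update r v (S.erase v).card w = r w :=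
          fun w hw => Function.update_of_ne hw _ _
        have heq : Function.update r v (S.erase v).card v = (S.erase v).card :=
          Function.update_self ..
        refine ⟨Function.update r v (S.erase v).card, ?_, ?_, ?_⟩
        · intro a ha b hb hab
          have h1 := hlt a
          have h2 := hlt b
          by_cases hav : a = v <;> by_cases hbv : b = v
          · rw [hav, hbv]
          · rw [hav, heq, hne b hbv] at hab
            exact absurd hab (h2 (Finset.mem_erase.2 ⟨hbv, hb⟩)).ne'
          · rw [hbv, heq, hne a hav] at hab
            exact absurd hab (h1 (Finset.mem_erase.2 ⟨hav, ha⟩)).ne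
          · rw [hne a hav, hne b hbv] at hab
            exact hr (Finset.mem_coe.2 (Finset.mem_erase.2 ⟨hav, ha⟩))
              (Finset.mem_coe.2 (Finset.mem_erase.2 ⟨hbv, hb⟩)) hab
        · intro a ha
          by_cases hav : a = v
          · rw [hav, heq]; omega
          · rw [hne a hav]
            have := hlt a (Finset.mem_erase.2 ⟨hav, ha⟩)
            omega
        · intro a ha
          by_cases hav : a = v
          · subst hav
            exact hvc.subset (by intro w hw; exact ⟨hw.1, hw.2.2⟩)
          · have haS := Finset.mem_erase.2 ⟨hav, ha⟩
            refine (hc a haS).subset fun w hw => ?_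
            obtain ⟨hwS, hwa, hadj⟩ := hw
            rw [hne a hav] at hwa
            by_cases hwv : w = v
            · rw [hwv, heq] at hwa
              exact absurd hwa (hlt a haS).not_gt
            · rw [hne w hwv] at hwa
              exact ⟨Finset.mem_erase.2 ⟨hwv, hwS⟩, hwa, hadj⟩
  obtain ⟨r, hr, -, hc⟩ := key Finset.univ
  refine ⟨r, fun a b h => hr (by simp) (by simp) h, fun v => ?_⟩
  simpa using hc v (Finset.mem_univ v)

end IsChordal

end Chordal

theorem Polynomial.derivative_eval_div_prod_X_sub_C {ι : Type*} (s : Finset ι) (d : ι → ℝ) (x : ℝ)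
    (h : ∀ i ∈ s, x - d i ≠ 0) :
    (derivative (∏ i ∈ s, (X - C (d i)))).eval x / (∏ i ∈ s, (X - C (d i))).eval x =
      ∑ i ∈ s, (x - d i)⁻¹ := by
  classical
  induction s using Finset.induction_on with
  | empty => simp
  | insert i s hi ih =>
    have h1 : x - d i ≠ 0 := h i (by simp)
    have h2 : (∏ i ∈ s, (X - C (d i))).eval x ≠ 0 := by
      rw [eval_prod, Finset.prod_ne_zero_iff]
      intro j hj
      simpa using h j (by simp [hj])
    rw [Finset.sum_insert hi, ← ih fun j hj => h j (by simp [hj]), Finset.prod_insert hi]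
    simp only [derivative_mul, eval_add, eval_mul, derivative_sub, derivative_X, derivative_C,
      sub_zero, eval_sub, eval_X, eval_C, one_mul]
    field_simp

theorem stmt6 {V : Type*} [Fintype V] (G Q : SimpleGraph V)
    (hQG : Q ≤ G) (hne : Q ≠ G) (hch : IsChordal Q)
    (P PQ : Polynomial ℝ) (hP : IsChromPoly G P) (hPQ : IsChromPoly Q PQ)
    (x : ℝ) (hx : x < 0) :
    (Polynomial.derivative PQ).eval x / PQ.eval x <
      (Polynomial.derivative P).eval x / P.eval x := by
  classical
  obtain ⟨r, hr, hc⟩ := hch.exists_elimination_ordering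
  obtain ⟨F, hF⟩ := SetFun.exists_isPowPoly G.indepFun G.indepFun_empty
  obtain ⟨FQ, hFQ⟩ := SetFun.exists_isPowPoly Q.indepFun Q.indepFun_empty
  let K : V → Finset V := fun v => {u | r u < r v ∧ Q.Adj v u}
  have hKr : ∀ u v, u ∈ K v ↔ r u < r v ∧ Q.Adj v u := fun u v => by simp [K]
  have hK : ∀ v, Q.IsClique (K v : Set V) := fun v => by simpa [K] using hc v
  have hPF : P = F Finset.univ := Polynomial.ext_eval_nat fun k => by
    rw [hP, hF, G.card_coloring]
  have hPQF : PQ = ∏ v, (X - C ((K v).card : ℝ)) := by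
    rw [← IsColPoly.eq_prod hFQ hr hKr hK Finset.univ (by simp)]
    exact Polynomial.ext_eval_nat fun k => by rw [hPQ, hFQ, Q.card_coloring]
  obtain ⟨y, rfl⟩ : ∃ y, x = -y := ⟨-x, by simp⟩
  have hy : 0 < y := by linarith
  obtain ⟨v, w, hvw, hw, hwK⟩ : ∃ v w, r w < r v ∧ G.Adj w v ∧ w ∉ K v := by
    obtain ⟨a, b, hG, hQ⟩ : ∃ a b, G.Adj a b ∧ ¬ Q.Adj a b := by
      by_contra! h
      exact hne (le_antisymm hQG fun a b => h a b)
    rcases lt_trichotomy (r a) (r b) with h | h | h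
    · exact ⟨b, a, h, hG, fun hm => hQ ((hKr a b).1 hm).2.symm⟩
    · exact absurd (hr h) hG.ne
    · exact ⟨a, b, h, hG.symm, fun hm => hQ ((hKr b a).1 hm).2⟩
  have hlt := IsColPoly.absLin_mul_absEval_lt hF hr (K := K) (fun v u hu => ((hKr u v).1 hu).1)
    (fun v => (hK v).mono hQG) (fun v u hu => hQG ((hKr u v).1 hu).2.symm) hwK hw hvw hy
  have hq := IsColPoly.absEval_pos hF hy Finset.univ
  have hG : (derivative P).eval (-y) / P.eval (-y) =
      -((absLin F * absEval F y) Finset.univ / absEval F y Finset.univ) := by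
    have h1 : absEval F y Finset.univ =
        (-1) ^ (Finset.univ : Finset V).card * (F Finset.univ).eval (-y) := rfl
    have h2 : ((-1 : ℝ) ^ (Finset.univ : Finset V).card) ≠ 0 := by simp
    have h3 : (F Finset.univ).eval (-y) =
        (-1) ^ (Finset.univ : Finset V).card * absEval F y Finset.univ := by
      rw [h1, ← mul_assoc, ← pow_add, Even.neg_one_pow ⟨_, rfl⟩, one_mul]
    rw [hPF, IsColPoly.derivative_eval_neg hF, h3, neg_mul, neg_div, mul_div_mul_left _ _ h2]
  have hd : ∀ v, y + (K v).card ≠ 0 := fun v => by positivity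
  rw [hG, hPQF, Polynomial.derivative_eval_div_prod_X_sub_C]
  · have h1 : ∑ v, (-y - ((K v).card : ℝ))⁻¹ = -∑ v, (y + ((K v).card : ℝ))⁻¹ := by
      rw [← Finset.sum_neg_distrib]
      refine Finset.sum_congr rfl fun v _ => ?_
      rw [← inv_neg, neg_add, sub_eq_add_neg]
    rw [h1, neg_lt_neg_iff, div_lt_iff₀' hq]
    exact hlt
  · intro v _ h
    exact hd v (by linarith)
end

section
/- For any non-complete simple graph G = (V, E) of order n and any real x < 0, (−1)^n (x − n + 1) ∑_{u∈V} P(G − u, x) + (−1)^{n+1} n P(G, x) > 0. -/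
open Polynomial

namespace ChromIneq

variable {V : Type*}

/-- `G` with the edge between `v` and `w` removed. -/
def del (G : SimpleGraph V) (v w : V) : SimpleGraph V where
  Adj a b := G.Adj a b ∧ ¬ (a = v ∧ b = w) ∧ ¬ (a = w ∧ b = v)
  symm := ⟨fun _ _ h => ⟨h.1.symm, fun h' => h.2.2 ⟨h'.2, h'.1⟩, fun h' => h.2.1 ⟨h'.2, h'.1⟩⟩⟩
  loopless := ⟨fun _ h => h.1.ne rfl⟩

/-- `G` with the neighbours of `w` made adjacent to `v`; away from `w` this is the contraction
of the edge between `v` and `w`. -/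
def con (G : SimpleGraph V) (v w : V) : SimpleGraph V where
  Adj a b := a ≠ b ∧ (G.Adj a b ∨ (a = v ∧ G.Adj w b) ∨ (b = v ∧ G.Adj w a))
  symm := ⟨fun _ _ h => ⟨h.1.symm, by
    rcases h.2 with h | h | h
    · exact Or.inl h.symm
    · exact Or.inr (Or.inr h)
    · exact Or.inr (Or.inl h)⟩⟩
  loopless := ⟨fun _ h => h.1 rfl⟩

theorem del_adj_iff_of_ne_right {G : SimpleGraph V} {v w a b : V} (h : a ≠ w) (h' : b ≠ w) :
    G.Adj a b ↔ (del G v w).Adj a b := by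
  simp [del, h, h']

theorem con_adj_iff_of_ne {G : SimpleGraph V} {v w a b : V} (h : a ≠ v) (h' : b ≠ v) :
    G.Adj a b ↔ (con G v w).Adj a b := by
  simp only [con, h, h', false_and, or_false]
  exact ⟨fun hab => ⟨hab.ne, hab⟩, And.right⟩

theorem del_adj_iff_of_ne_left {G : SimpleGraph V} {v w a b : V} (h : a ≠ v) (h' : b ≠ v) :
    G.Adj a b ↔ (del G v w).Adj a b := by
  simp [del, h, h']

open Classical in
theorem card_erase_add_one {S : Finset V} {v : V} (hv : v ∈ S) : S.card = (S.erase v).card + 1 :=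
  (Finset.card_erase_add_one hv).symm

open Classical in
/-- Induction by deletion and contraction of edges at a fixed vertex `v`. -/
theorem del_con_induction (v : V) {M : SimpleGraph V → Finset V → Prop}
    (isolated : ∀ G S, v ∈ S → (∀ w ∈ S, ¬ G.Adj v w) → M G S)
    (edge : ∀ G S w, v ∈ S → w ∈ S → G.Adj v w →
      M (del G v w) S → M (con G v w) (S.erase w) → M G S) :
    ∀ G S, v ∈ S → M G S := by
  suffices h : ∀ n d : ℕ, ∀ G : SimpleGraph V, ∀ S : Finset V, v ∈ S → S.card = n →
      (S.filter (G.Adj v)).card = d → M G S from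
    fun G S hv => h _ _ G S hv rfl rfl
  intro n
  induction n with
  | zero =>
    intro d G S hv hS
    simp [Finset.card_eq_zero.mp hS] at hv
  | succ n ihn =>
    intro d
    induction d with
    | zero =>
      intro G S hv _ hd
      refine isolated G S hv fun w hw hvw => ?_
      have : w ∈ S.filter (G.Adj v) := by simp [hw, hvw]
      simp [Finset.card_eq_zero.mp hd] at this
    | succ d ihd =>
      intro G S hv hS hd
      obtain ⟨w, hw⟩ := Finset.card_pos.mp (by omega : 0 < (S.filter (G.Adj v)).card)
      have hw' := Finset.mem_filter.mp hw
      refine edge G S w hv hw'.1 hw'.2 (ihd _ S hv hS ?_)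
        (ihn _ _ _ (Finset.mem_erase.mpr ⟨hw'.2.ne, hv⟩) ?_ rfl)
      · have : S.filter ((del G v w).Adj v) = (S.filter (G.Adj v)).erase w := by
          ext b
          have := hw'.2.ne
          simp only [Finset.mem_filter, Finset.mem_erase, del]
          grind
        rw [this, Finset.card_erase_of_mem hw, hd]
        rfl
      · rw [Finset.card_erase_of_mem hw'.1, hS]
        rfl

variable [Fintype V]

open Classical in
/-- The proper colorings of the subgraph induced by `S` with colors below `k`, extended by `0`
outside `S`. -/
noncomputable def colorings (G : SimpleGraph V) (S : Finset V) (k : ℕ) : Finset (V → ℕ) :=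
  (Fintype.piFinset fun v => if v ∈ S then Finset.range k else {0}).filter
    fun f => ∀ a ∈ S, ∀ b ∈ S, G.Adj a b → f a ≠ f b

theorem mem_colorings {G : SimpleGraph V} {S : Finset V} {k : ℕ} {f : V → ℕ} :
    f ∈ colorings G S k ↔ (∀ a ∈ S, f a < k) ∧ (∀ a ∉ S, f a = 0) ∧
      ∀ a ∈ S, ∀ b ∈ S, G.Adj a b → f a ≠ f b := by
  classical
  simp only [colorings, Finset.mem_filter, Fintype.mem_piFinset, ← and_assoc]
  refine and_congr_left fun _ => ⟨fun h => ⟨fun a ha => ?_, fun a ha => ?_⟩, fun h a => ?_⟩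
  · simpa [ha] using h a
  · simpa [ha] using h a
  · by_cases ha : a ∈ S
    · simpa [ha] using h.1 a ha
    · simpa [ha] using h.2 a ha

theorem natCard_coloring {W : Type*} {H : SimpleGraph W} {G : SimpleGraph V} (φ : H ↪g G)
    {S : Finset V} (hS : ∀ v, v ∈ S ↔ v ∈ Set.range φ) (k : ℕ) :
    Nat.card (H.Coloring (Fin k)) = (colorings G S k).card := by
  rw [← Nat.card_eq_finsetCard]
  have hmem : ∀ w, φ w ∈ S := fun w => (hS _).mpr ⟨w, rfl⟩
  refine Nat.card_congr (Equiv.ofBijective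
    (fun c => ⟨Function.extend φ (fun w => (c w : ℕ)) 0, ?_⟩) ⟨?_, ?_⟩)
  · rw [mem_colorings]
    refine ⟨fun a ha => ?_, fun a ha => ?_, fun a ha b hb hab => ?_⟩
    · obtain ⟨w, rfl⟩ := (hS a).mp ha
      rw [φ.injective.extend_apply]
      exact (c w).2
    · rw [Function.extend_apply']
      · rfl
      · exact fun h => ha ((hS a).mpr h)
    · obtain ⟨w, rfl⟩ := (hS a).mp ha
      obtain ⟨w', rfl⟩ := (hS b).mp hb
      rw [φ.injective.extend_apply, φ.injective.extend_apply]
      exact fun h => c.valid (φ.map_adj_iff.mp hab) (Fin.ext h)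
  · intro c c' h
    ext w
    have := congrFun (Subtype.ext_iff.mp h) (φ w)
    simpa [φ.injective.extend_apply] using this
  · rintro ⟨f, hf⟩
    rw [mem_colorings] at hf
    refine ⟨SimpleGraph.Coloring.mk (fun w => ⟨f (φ w), hf.1 _ (hmem w)⟩) ?_, ?_⟩
    · intro a b hab h
      exact hf.2.2 _ (hmem a) _ (hmem b) (φ.map_adj_iff.mpr hab) (Fin.ext_iff.mp h)
    · refine Subtype.ext (funext fun v => ?_)
      by_cases hv : ∃ w, φ w = v
      · obtain ⟨w, rfl⟩ := hv
        simp only [φ.injective.extend_apply]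
        rfl
      · simp only [Function.extend_apply' _ _ _ hv]
        exact (hf.2.1 v fun h => hv ((hS v).mp h)).symm

theorem colorings_congr {G G' : SimpleGraph V} {S : Finset V}
    (h : ∀ a ∈ S, ∀ b ∈ S, G.Adj a b ↔ G'.Adj a b) (k : ℕ) :
    colorings G S k = colorings G' S k := by
  ext f
  rw [mem_colorings, mem_colorings]
  grind

theorem card_colorings_empty (G : SimpleGraph V) (k : ℕ) : (colorings G ∅ k).card = 1 := by
  rw [Finset.card_eq_one]
  refine ⟨0, ?_⟩
  ext f
  rw [mem_colorings]
  simp [funext_iff]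

open Classical in
theorem card_colorings_isolated {G : SimpleGraph V} {S : Finset V} {v : V} (hv : v ∈ S)
    (h : ∀ w ∈ S, ¬ G.Adj v w) (k : ℕ) :
    (colorings G S k).card = k * (colorings G (S.erase v) k).card := by
  have h' : ∀ w ∈ S, ¬ G.Adj w v := fun w hw hwv => h w hw hwv.symm
  have : k * (colorings G (S.erase v) k).card =
      (Finset.range k ×ˢ colorings G (S.erase v) k).card := by simp
  rw [this]
  refine Finset.card_nbij' (fun f => (f v, Function.update f v 0))
    (fun p => Function.update p.2 v p.1) ?_ ?_ ?_ ?_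
  · intro f hf
    simp only [Finset.mem_coe, Finset.mem_product, mem_colorings, Finset.mem_range,
      Finset.mem_erase, Function.update_apply] at hf ⊢
    grind
  · rintro ⟨i, f⟩ hf
    simp only [Finset.mem_coe, Finset.mem_product, mem_colorings, Finset.mem_range,
      Finset.mem_erase, Function.update_apply] at hf ⊢
    grind
  · intro f _
    simp
  · rintro ⟨i, f⟩ hf
    simp only [Finset.mem_coe, Finset.mem_product, mem_colorings, Finset.mem_erase] at hf
    have : f v = 0 := hf.2.2.1 v (by simp)
    simp [← this]

open Classical in
theorem card_colorings_del {G : SimpleGraph V} {S : Finset V} {v w : V} (hv : v ∈ S)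
    (hw : w ∈ S) (hvw : G.Adj v w) (k : ℕ) :
    (colorings (del G v w) S k).card =
      (colorings G S k).card + (colorings (con G v w) (S.erase w) k).card := by
  have hne := hvw.ne
  have hirr : ∀ a, ¬ G.Adj a a := fun a h => h.ne rfl
  have hsymm : ∀ a b, G.Adj a b ↔ G.Adj b a := fun a b => G.adj_comm a b
  rw [← Finset.card_filter_add_card_filter_not (s := colorings (del G v w) S k)
    (fun f => f v ≠ f w)]
  congr 1
  · congr 1
    ext f
    simp only [Finset.mem_filter, mem_colorings, del]
    grind
  · refine Finset.card_nbij' (fun f => Function.update f w 0)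
      (fun f => Function.update f w (f v)) ?_ ?_ ?_ ?_
    · intro f hf
      simp only [Finset.coe_filter, Set.mem_ofPred_eq, Finset.mem_coe, mem_colorings, not_not,
        Finset.mem_erase, Function.update_apply, del, con] at hf ⊢
      grind
    · intro f hf
      simp only [Finset.coe_filter, Set.mem_ofPred_eq, Finset.mem_coe, mem_colorings, not_not,
        Finset.mem_erase, Function.update_apply, del, con] at hf ⊢
      grind
    · intro f hf
      simp only [Finset.coe_filter, Set.mem_ofPred_eq, not_not] at hf
      simp [Function.update_of_ne hne, hf.2]
    · intro f hf
      simp only [Finset.mem_coe, mem_colorings] at hf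
      have : f w = 0 := hf.2.1 w (by simp)
      simp [← this]

theorem eq_of_eval_neg_natCast {P Q : ℝ[X]}
    (h : ∀ k : ℕ, P.eval (-(k : ℝ)) = Q.eval (-(k : ℝ))) : P = Q := by
  refine Polynomial.eq_of_infinite_eval_eq P Q
    (Set.Infinite.mono (s := Set.range fun k : ℕ => -(k : ℝ)) ?_
      (Set.infinite_range_of_injective fun a b hab => by simpa using hab))
  rintro _ ⟨k, rfl⟩
  exact h k

open Classical in
theorem exists_signedPoly (n : ℕ) : ∀ (G : SimpleGraph V) (S : Finset V), S.card ≤ n →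
    ∃ A : ℝ[X], (∀ k : ℕ, A.eval (-(k : ℝ)) = (-1) ^ S.card * (colorings G S k).card) ∧
      ∀ q : ℝ, 0 < q → 0 < A.eval q := by
  have empty : ∀ G : SimpleGraph V, ∃ A : ℝ[X],
      (∀ k : ℕ, A.eval (-(k : ℝ)) =
        (-1) ^ (∅ : Finset V).card * (colorings G ∅ k).card) ∧ ∀ q : ℝ, 0 < q → 0 < A.eval q :=
    fun G => ⟨1, by simp [card_colorings_empty]⟩
  induction n with
  | zero =>
    intro G S hS
    obtain rfl : S = ∅ := by simpa using hS
    exact empty G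
  | succ n ih =>
    intro G S hS
    obtain rfl | ⟨v, hv⟩ := S.eq_empty_or_nonempty
    · exact empty G
    revert hS
    refine del_con_induction v (M := fun G S => S.card ≤ n + 1 → ∃ A : ℝ[X],
      (∀ k : ℕ, A.eval (-(k : ℝ)) = (-1) ^ S.card * (colorings G S k).card) ∧
        ∀ q : ℝ, 0 < q → 0 < A.eval q) ?_ ?_ G S hv
    · intro G S hv hiso hS
      have hc := card_erase_add_one hv
      obtain ⟨A, hA, hpos⟩ := ih G (S.erase v) (by omega)
      refine ⟨X * A, fun k => ?_, fun q hq => ?_⟩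
      · rw [eval_mul, eval_X, hA, card_colorings_isolated hv hiso, hc]
        push_cast
        ring
      · rw [eval_mul, eval_X]
        exact mul_pos hq (hpos q hq)
    · intro G S w hv hw hvw h₁ h₂ hS
      have hc := card_erase_add_one hw
      obtain ⟨A, hA, hApos⟩ := h₁ hS
      obtain ⟨B, hB, hBpos⟩ := h₂ (by omega)
      refine ⟨A + B, fun k => ?_, fun q hq => ?_⟩
      · rw [eval_add, hA, hB, card_colorings_del hv hw hvw, hc]
        push_cast
        ring
      · rw [eval_add]
        exact add_pos (hApos q hq) (hBpos q hq)

/-- The polynomial `(-1) ^ |S| * P(G[S], -x)`, where `P` is the chromatic polynomial. -/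
noncomputable def signedPoly (G : SimpleGraph V) (S : Finset V) : ℝ[X] :=
  (exists_signedPoly S.card G S le_rfl).choose

theorem eval_signedPoly (G : SimpleGraph V) (S : Finset V) (k : ℕ) :
    (signedPoly G S).eval (-(k : ℝ)) = (-1) ^ S.card * (colorings G S k).card :=
  (exists_signedPoly S.card G S le_rfl).choose_spec.1 k

theorem signedPoly_pos (G : SimpleGraph V) (S : Finset V) {q : ℝ} (hq : 0 < q) :
    0 < (signedPoly G S).eval q :=
  (exists_signedPoly S.card G S le_rfl).choose_spec.2 q hq

theorem signedPoly_empty (G : SimpleGraph V) : signedPoly G ∅ = 1 :=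
  eq_of_eval_neg_natCast fun k => by simp [eval_signedPoly, card_colorings_empty]

theorem signedPoly_congr {G G' : SimpleGraph V} {S : Finset V}
    (h : ∀ a ∈ S, ∀ b ∈ S, G.Adj a b ↔ G'.Adj a b) : signedPoly G S = signedPoly G' S :=
  eq_of_eval_neg_natCast fun k => by simp [eval_signedPoly, colorings_congr h]

open Classical in
theorem signedPoly_isolated {G : SimpleGraph V} {S : Finset V} {v : V} (hv : v ∈ S)
    (h : ∀ w ∈ S, ¬ G.Adj v w) : signedPoly G S = X * signedPoly G (S.erase v) :=
  eq_of_eval_neg_natCast fun k => by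
    rw [eval_mul, eval_X, eval_signedPoly, eval_signedPoly, card_colorings_isolated hv h,
      card_erase_add_one hv]
    push_cast
    ring

open Classical in
theorem signedPoly_eq_del_add_con {G : SimpleGraph V} {S : Finset V} {v w : V} (hv : v ∈ S)
    (hw : w ∈ S) (hvw : G.Adj v w) :
    signedPoly G S = signedPoly (del G v w) S + signedPoly (con G v w) (S.erase w) :=
  eq_of_eval_neg_natCast fun k => by
    rw [eval_add, eval_signedPoly, eval_signedPoly, eval_signedPoly,
      card_colorings_del hv hw hvw, card_erase_add_one hw]
    push_cast
    ring

theorem coeff_zero_signedPoly (G : SimpleGraph V) {S : Finset V} (hS : S.Nonempty) :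
    (signedPoly G S).coeff 0 = 0 := by
  obtain ⟨v, hv⟩ := hS
  refine del_con_induction v (M := fun G S => (signedPoly G S).coeff 0 = 0) ?_ ?_ G S hv
  · intro G S hv hiso
    simp [signedPoly_isolated hv hiso]
  · intro G S w hv hw hvw h₁ h₂
    rw [signedPoly_eq_del_add_con hv hw hvw, coeff_add, h₁, h₂, add_zero]

/-- The absolute value of the linear coefficient of the chromatic polynomial of `G[S]`. -/
noncomputable def linCoeff (G : SimpleGraph V) (S : Finset V) : ℝ := (signedPoly G S).coeff 1

theorem linCoeff_congr {G G' : SimpleGraph V} {S : Finset V}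
    (h : ∀ a ∈ S, ∀ b ∈ S, G.Adj a b ↔ G'.Adj a b) : linCoeff G S = linCoeff G' S := by
  rw [linCoeff, signedPoly_congr h, linCoeff]

theorem linCoeff_singleton (G : SimpleGraph V) (v : V) : linCoeff G {v} = 1 := by
  classical
  rw [linCoeff, signedPoly_isolated (Finset.mem_singleton_self v) (by simp)]
  simp [signedPoly_empty]

theorem linCoeff_isolated {G : SimpleGraph V} {S : Finset V} {v : V} (hv : v ∈ S)
    (h : ∀ w ∈ S, ¬ G.Adj v w) (hS : S ≠ {v}) : linCoeff G S = 0 := by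
  classical
  rw [linCoeff, signedPoly_isolated hv h, coeff_X_mul, coeff_zero_signedPoly]
  rw [← Finset.card_pos]
  have := card_erase_add_one hv
  by_contra h0
  exact hS (Finset.eq_singleton_iff_unique_mem.mpr ⟨hv,
    fun x hx => Finset.card_le_one.mp (by omega) x hx v hv⟩)

open Classical in
theorem linCoeff_eq_del_add_con {G : SimpleGraph V} {S : Finset V} {v w : V} (hv : v ∈ S)
    (hw : w ∈ S) (hvw : G.Adj v w) :
    linCoeff G S = linCoeff (del G v w) S + linCoeff (con G v w) (S.erase w) := by
  rw [linCoeff, signedPoly_eq_del_add_con hv hw hvw, coeff_add]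
  rfl

theorem linCoeff_nonneg (G : SimpleGraph V) (S : Finset V) : 0 ≤ linCoeff G S := by
  obtain rfl | ⟨v, hv⟩ := S.eq_empty_or_nonempty
  · simp [linCoeff, signedPoly_empty, coeff_one]
  refine del_con_induction v (M := fun G S => 0 ≤ linCoeff G S) ?_ ?_ G S hv
  · intro G S hv hiso
    by_cases hS : S = {v}
    · simp [hS, linCoeff_singleton]
    · exact (linCoeff_isolated hv hiso hS).ge
  · intro G S w hv hw hvw h₁ h₂
    rw [linCoeff_eq_del_add_con hv hw hvw]
    exact add_nonneg h₁ h₂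

open Classical in
theorem linCoeff_le_sum_erase (G : SimpleGraph V) {S : Finset V} {v : V} (hv : v ∈ S)
    (hS : 2 ≤ S.card) : linCoeff G S ≤ ∑ u ∈ S.erase v, linCoeff G (S.erase u) := by
  revert hS
  refine del_con_induction v (M := fun G S => 2 ≤ S.card →
    linCoeff G S ≤ ∑ u ∈ S.erase v, linCoeff G (S.erase u)) ?_ ?_ G S hv
  · intro G S hv hiso hS
    rw [linCoeff_isolated hv hiso (by rintro rfl; simp at hS)]
    exact Finset.sum_nonneg fun u _ => linCoeff_nonneg G _
  · intro G S w hv hw hvw h₁ h₂ hS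
    have hne := hvw.ne
    have hwv : w ∈ S.erase v := Finset.mem_erase.mpr ⟨hne.symm, hw⟩
    have hdel : linCoeff G (S.erase w) = linCoeff (del G v w) (S.erase w) :=
      linCoeff_congr fun a ha b hb =>
        del_adj_iff_of_ne_right (Finset.ne_of_mem_erase ha) (Finset.ne_of_mem_erase hb)
    have key : ∑ u ∈ S.erase v, linCoeff G (S.erase u) =
        ∑ u ∈ S.erase v, linCoeff (del G v w) (S.erase u) +
          ∑ u ∈ (S.erase w).erase v, linCoeff (con G v w) ((S.erase w).erase u) := by
      rw [← Finset.add_sum_erase _ _ hwv, ← Finset.add_sum_erase _ _ hwv, hdel, add_assoc,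
        Finset.erase_right_comm (a := w), ← Finset.sum_add_distrib]
      congr 1
      refine Finset.sum_congr rfl fun u hu => ?_
      simp only [Finset.mem_erase] at hu
      rw [linCoeff_eq_del_add_con (v := v) (w := w) (by simp [hv, hu.2.1.symm])
        (by simp [hw, hu.1.symm]) hvw, Finset.erase_right_comm]
    rw [key, linCoeff_eq_del_add_con hv hw hvw]
    by_cases h3 : 3 ≤ S.card
    · exact add_le_add (h₁ hS) (h₂ (by have := card_erase_add_one hw; omega))
    · have hSw : S.erase w = {v} := by
        have := card_erase_add_one hw
        obtain ⟨x, hx⟩ := Finset.card_eq_one.mp (by omega : (S.erase w).card = 1)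
        have : v ∈ S.erase w := Finset.mem_erase.mpr ⟨hne, hv⟩
        rw [hx] at this ⊢
        rw [Finset.mem_singleton.mp this]
      have hmem : ∀ b ∈ S, b = w ∨ b = v := fun b hb => by
        by_contra! h
        have : b ∈ S.erase w := Finset.mem_erase.mpr ⟨h.1, hb⟩
        rw [hSw] at this
        exact h.2 (Finset.mem_singleton.mp this)
      have h0 : linCoeff (del G v w) S = 0 := by
        refine linCoeff_isolated hv (fun b hb h => ?_) (by rintro rfl; simp at hS)
        rcases hmem b hb with rfl | rfl
        · exact h.2.1 ⟨rfl, rfl⟩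
        · exact h.ne rfl
      have h1 := Finset.single_le_sum (f := fun u => linCoeff (del G v w) (S.erase u))
        (fun u _ => linCoeff_nonneg _ _) hwv
      simp only [hSw, linCoeff_singleton] at h1 ⊢
      rw [h0]
      simpa using h1

open Classical in
/-- Removing a vertex from a graph on at least two vertices: averaged bound for the linear
coefficient. -/
theorem card_mul_linCoeff_le (G : SimpleGraph V) {S : Finset V} (hS : 2 ≤ S.card) :
    S.card * linCoeff G S ≤ ((S.card : ℝ) - 1) * ∑ u ∈ S, linCoeff G (S.erase u) := by
  have h := Finset.sum_le_sum fun v (hv : v ∈ S) => linCoeff_le_sum_erase G hv hS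
  have hsum : ∀ v ∈ S, ∑ u ∈ S.erase v, linCoeff G (S.erase u) =
      ∑ u ∈ S, linCoeff G (S.erase u) - linCoeff G (S.erase v) := fun v hv => by
    rw [← Finset.add_sum_erase _ _ hv]
    ring
  rw [Finset.sum_congr rfl hsum, Finset.sum_sub_distrib, Finset.sum_const, Finset.sum_const,
    nsmul_eq_mul, nsmul_eq_mul] at h
  linarith

open Classical in
/-- Sum over the part containing a distinguished vertex `v`. -/
theorem eval_signedPoly_eq_sum (G : SimpleGraph V) {S : Finset V} {v : V} (hv : v ∈ S) (q : ℝ) :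
    (signedPoly G S).eval q = q * ∑ B ∈ S.powerset,
      if v ∈ B then linCoeff G B * (signedPoly G (S \ B)).eval q else 0 := by
  refine del_con_induction v (M := fun G S => (signedPoly G S).eval q = q * ∑ B ∈ S.powerset,
    if v ∈ B then linCoeff G B * (signedPoly G (S \ B)).eval q else 0) ?_ ?_ G S hv
  · intro G S hv hiso
    rw [signedPoly_isolated hv hiso, eval_mul, eval_X, Finset.sum_eq_single {v}]
    · simp [linCoeff_singleton, Finset.sdiff_singleton_eq_erase]
    · intro B hB hne
      split_ifs with hvB
      · rw [linCoeff_isolated hvB (fun w hw => hiso w (Finset.mem_powerset.mp hB hw)) hne,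
          zero_mul]
      · rfl
    · simp [hv]
  · intro G S w hv hw hvw h₁ h₂
    have hne := hvw.ne
    rw [signedPoly_eq_del_add_con hv hw hvw, eval_add, h₁, h₂, ← mul_add]
    congr 1
    rw [← Finset.insert_erase hw, Finset.sum_powerset_insert (Finset.notMem_erase w S),
      Finset.sum_powerset_insert (Finset.notMem_erase w S), Finset.insert_erase hw, add_assoc,
      ← Finset.sum_add_distrib]
    congr 1
    · refine Finset.sum_congr rfl fun B hB => ?_
      have hB := Finset.mem_powerset.mp hB
      split_ifs with hvB
      · congr 1
        · exact (linCoeff_congr fun a ha b hb => del_adj_iff_of_ne_right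
            (Finset.ne_of_mem_erase (hB ha)) (Finset.ne_of_mem_erase (hB hb))).symm
        · rw [signedPoly_congr fun a ha b hb => (del_adj_iff_of_ne_left (by grind) (by grind)).symm]
      · rfl
    · refine Finset.sum_congr rfl fun B hB => ?_
      have hB := Finset.mem_powerset.mp hB
      have hwB : w ∉ B := fun h => Finset.notMem_erase w S (hB h)
      by_cases hvB : v ∈ B
      · have hd : S \ insert w B = S.erase w \ B := by grind
        have e₁ : signedPoly (del G v w) (S.erase w \ B) = signedPoly G (S.erase w \ B) :=
          signedPoly_congr fun a ha b hb => (del_adj_iff_of_ne_left (by grind) (by grind)).symm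
        have e₂ : signedPoly (con G v w) (S.erase w \ B) = signedPoly G (S.erase w \ B) :=
          signedPoly_congr fun a ha b hb => (con_adj_iff_of_ne (by grind) (by grind)).symm
        rw [if_pos (Finset.mem_insert_of_mem hvB), if_pos hvB,
          if_pos (Finset.mem_insert_of_mem hvB), hd, e₁, e₂,
          linCoeff_eq_del_add_con (S := insert w B) (Finset.mem_insert_of_mem hvB)
            (Finset.mem_insert_self w B) hvw, Finset.erase_insert hwB]
        ring
      · simp [hvB, hne]

open Classical in
theorem card_mul_eval_signedPoly (G : SimpleGraph V) (S : Finset V) (q : ℝ) :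
    S.card * (signedPoly G S).eval q = q * ∑ B ∈ S.powerset,
      B.card * (linCoeff G B * (signedPoly G (S \ B)).eval q) := by
  rw [← nsmul_eq_mul, ← Finset.sum_const,
    Finset.sum_congr rfl fun v hv => eval_signedPoly_eq_sum G hv q, ← Finset.mul_sum,
    Finset.sum_comm]
  congr 1
  refine Finset.sum_congr rfl fun B hB => ?_
  rw [← Finset.sum_filter, Finset.sum_const, nsmul_eq_mul, Finset.filter_mem_eq_inter,
    Finset.inter_eq_right.mpr (Finset.mem_powerset.mp hB)]

open Classical in
theorem sum_powerset_erase_linCoeff (G : SimpleGraph V) {S : Finset V} {u : V} (hu : u ∈ S)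
    (q : ℝ) :
    q * ∑ B ∈ S.powerset, (if u ∈ B then
      ((B.card : ℝ) - 1) * linCoeff G (B.erase u) * (signedPoly G (S \ B)).eval q else 0) =
      ((S.card : ℝ) - 1) * (signedPoly G (S.erase u)).eval q := by
  have hS : (S.card : ℝ) - 1 = (S.erase u).card := by
    rw [card_erase_add_one hu]
    push_cast
    ring
  rw [hS, card_mul_eval_signedPoly]
  congr 1
  conv_lhs => rw [← Finset.insert_erase hu, Finset.sum_powerset_insert (Finset.notMem_erase u S)]
  rw [Finset.insert_erase hu, Finset.sum_eq_zero, zero_add]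
  · refine Finset.sum_congr rfl fun B hB => ?_
    have hB := Finset.mem_powerset.mp hB
    have huB : u ∉ B := fun h => Finset.notMem_erase u S (hB h)
    have hd : S \ insert u B = S.erase u \ B := by grind
    rw [if_pos (Finset.mem_insert_self u B), Finset.erase_insert huB, hd,
      Finset.card_insert_of_notMem huB]
    push_cast
    ring
  · intro B hB
    exact if_neg fun h => Finset.notMem_erase u S (Finset.mem_powerset.mp hB h)

open Classical in
theorem card_mul_eval_signedPoly_lt (G : SimpleGraph V) {S : Finset V} {a b : V} (ha : a ∈ S)
    (hb : b ∈ S) (hab : a ≠ b) (hadj : ¬ G.Adj a b) {q : ℝ} (hq : 0 < q) :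
    S.card * (signedPoly G S).eval q <
      (q + S.card - 1) * ∑ u ∈ S, (signedPoly G (S.erase u)).eval q := by
  have hsingle : ∀ u ∈ S, (signedPoly G (S.erase u)).eval q =
      ∑ B ∈ S.powerset, if B = {u} then (signedPoly G (S \ B)).eval q else 0 := fun u hu => by
    rw [Finset.sum_ite_eq', if_pos (by simpa using hu), Finset.sdiff_singleton_eq_erase]
  have hR : (q + S.card - 1) * ∑ u ∈ S, (signedPoly G (S.erase u)).eval q =
      q * ∑ B ∈ S.powerset, ((∑ u ∈ S, if B = {u} then 1 else 0) +
        ((B.card : ℝ) - 1) * ∑ u ∈ B, linCoeff G (B.erase u)) *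
          (signedPoly G (S \ B)).eval q := by
    have e₁ : q * ∑ u ∈ S, (signedPoly G (S.erase u)).eval q = q * ∑ B ∈ S.powerset,
        (∑ u ∈ S, if B = {u} then 1 else 0) * (signedPoly G (S \ B)).eval q := by
      rw [Finset.sum_congr rfl hsingle, Finset.sum_comm]
      simp only [Finset.sum_mul, ite_mul, one_mul, zero_mul]
    have e₂ : ((S.card : ℝ) - 1) * ∑ u ∈ S, (signedPoly G (S.erase u)).eval q =
        q * ∑ B ∈ S.powerset, ((B.card : ℝ) - 1) * (∑ u ∈ B, linCoeff G (B.erase u)) *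
          (signedPoly G (S \ B)).eval q := by
      rw [Finset.mul_sum,
        Finset.sum_congr rfl fun u hu => (sum_powerset_erase_linCoeff G hu q).symm,
        ← Finset.mul_sum, Finset.sum_comm]
      congr 1
      refine Finset.sum_congr rfl fun B hB => ?_
      rw [← Finset.sum_filter, Finset.filter_mem_eq_inter,
        Finset.inter_eq_right.mpr (Finset.mem_powerset.mp hB), Finset.mul_sum, Finset.sum_mul]
    simp only [add_mul, Finset.sum_add_distrib, mul_add]
    rw [← e₁, ← e₂]
    ring
  rw [hR, card_mul_eval_signedPoly]
  refine mul_lt_mul_of_pos_left (Finset.sum_lt_sum (fun B hB => ?_) ⟨{a, b}, ?_, ?_⟩) hq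
  · rw [← mul_assoc]
    refine mul_le_mul_of_nonneg_right ?_ (signedPoly_pos G _ hq).le
    have hnn : (0 : ℝ) ≤ ∑ u ∈ S, if B = {u} then 1 else 0 :=
      Finset.sum_nonneg fun u _ => by split_ifs <;> norm_num
    rcases lt_or_ge B.card 2 with h | h
    · obtain rfl | ⟨u, hu⟩ := B.eq_empty_or_nonempty
      · simp
      · obtain rfl : B = {u} := Finset.eq_singleton_iff_unique_mem.mpr
          ⟨hu, fun x hx => Finset.card_le_one.mp (by omega) x hx u hu⟩
        have huS : u ∈ S := Finset.mem_powerset.mp hB hu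
        simp [linCoeff_singleton, huS]
    · linarith [card_mul_linCoeff_le G h]
  · simp [Finset.insert_subset_iff, ha, hb]
  · rw [← mul_assoc]
    refine mul_lt_mul_of_pos_right ?_ (signedPoly_pos G _ hq)
    have hcard : ({a, b} : Finset V).card = 2 := Finset.card_pair hab
    have hz : linCoeff G {a, b} = 0 :=
      linCoeff_isolated (v := a) (by simp) (by simp [hadj]) fun h => by simp [h] at hcard
    have hnn : (0 : ℝ) ≤ ∑ u ∈ S, if ({a, b} : Finset V) = {u} then 1 else 0 :=
      Finset.sum_nonneg fun u _ => by split_ifs <;> norm_num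
    have ea : ({a, b} : Finset V).erase a = {b} := by grind
    have eb : ({a, b} : Finset V).erase b = {a} := by grind
    rw [hz, hcard, Finset.sum_pair hab, ea, eb, linCoeff_singleton, linCoeff_singleton]
    norm_num
    linarith

theorem eval_eq_signedPoly {W : Type*} {H : SimpleGraph W} {G : SimpleGraph V} (φ : H ↪g G)
    {S : Finset V} (hS : ∀ v, v ∈ S ↔ v ∈ Set.range φ) {P : ℝ[X]} (hP : IsChromPoly H P)
    (x : ℝ) : P.eval x = (-1) ^ S.card * (signedPoly G S).eval (-x) := by
  have : P.comp (-X) = C ((-1) ^ S.card) * signedPoly G S :=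
    eq_of_eval_neg_natCast fun k => by
      rw [eval_comp, eval_neg, eval_X, neg_neg, hP, eval_mul, eval_C, eval_signedPoly,
        natCard_coloring φ hS, ← mul_assoc, ← mul_pow]
      simp
  have h := congrArg (eval (-x)) this
  simpa [eval_comp] using h

end ChromIneq

theorem stmt9 {V : Type*} [Fintype V] (G : SimpleGraph V) (hnc : G ≠ ⊤)
    (P : Polynomial ℝ) (Pu : V → Polynomial ℝ) (hP : IsChromPoly G P)
    (hPu : ∀ u : V, IsChromPoly (G.induce {v | v ≠ u}) (Pu u))
    (x : ℝ) (hx : x < 0) :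
    0 < (-1 : ℝ) ^ (Fintype.card V) * (x - (Fintype.card V : ℝ) + 1) *
          ∑ u : V, (Pu u).eval x
        + (-1 : ℝ) ^ (Fintype.card V + 1) * (Fintype.card V : ℝ) * P.eval x := by
  classical
  obtain ⟨a, b, hab, hadj⟩ : ∃ a b, a ≠ b ∧ ¬ G.Adj a b := by
    by_contra! h
    exact hnc (eq_top_iff.mpr fun a b hab => h a b hab)
  have hlt := ChromIneq.card_mul_eval_signedPoly_lt G (Finset.mem_univ a) (Finset.mem_univ b)
    hab hadj (neg_pos.mpr hx)
  have eP : P.eval x = _ := ChromIneq.eval_eq_signedPoly (SimpleGraph.Embedding.refl (G := G))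
    (S := Finset.univ) (by simp) hP x
  have ePu : ∀ u, (Pu u).eval x = _ := fun u =>
    ChromIneq.eval_eq_signedPoly (SimpleGraph.Embedding.induce {v | v ≠ u})
      (S := Finset.univ.erase u) (by simp) (hPu u) x
  obtain ⟨n, hn⟩ : ∃ n, Fintype.card V = n + 1 :=
    Nat.exists_eq_add_one.mpr (Fintype.card_pos_iff.mpr ⟨a⟩)
  simp only [eP, ePu, Finset.card_erase_of_mem (Finset.mem_univ _), ← Finset.mul_sum,
    Finset.card_univ, hn, Nat.add_sub_cancel] at hlt ⊢
  have hs : ((-1 : ℝ) ^ n) * (-1) ^ n = 1 := by rw [← mul_pow]; simp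
  refine (sub_pos.mpr hlt).trans_eq ?_
  simp only [pow_succ]
  linear_combination (-((-x + ((n + 1 : ℕ) : ℝ) - 1) * ∑ u : V,
    (ChromIneq.signedPoly G (Finset.univ.erase u)).eval (-x)) + ((n + 1 : ℕ) : ℝ) *
      (ChromIneq.signedPoly G Finset.univ).eval (-x)) * hs
end

section
/- Let G be a connected simple graph of order n ≥ 3 that is neither complete nor a cycle. Then there exist two non-adjacent vertices u_1, u_2 of G such that G − {u_1, u_2} is connected. -/
open Polynomial

namespace SimpleGraph

variable {V : Type*} {G : SimpleGraph V}

/-- A vertex set is connected if from each of its vertices one can descend, along edges inside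
the set and with respect to some height function, to a fixed root. -/
theorem induce_connected_of_descent {s : Set V} {r : V} (hr : r ∈ s) (f : V → ℕ)
    (h : ∀ z ∈ s, z ≠ r → ∃ z' ∈ s, G.Adj z z' ∧ f z' < f z) : (G.induce s).Connected := by
  have key : ∀ n, ∀ z (hz : z ∈ s), f z = n → (G.induce s).Reachable ⟨z, hz⟩ ⟨r, hr⟩ := by
    intro n
    induction n using Nat.strong_induction_on with
    | _ n ih =>
      intro z hz hn
      by_cases hzr : z = r
      · subst hzr
        exact Reachable.refl _
      · obtain ⟨z', hz', hadj, hlt⟩ := h z hz hzr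
        have hstep : (G.induce s).Adj ⟨z, hz⟩ ⟨z', hz'⟩ := hadj
        exact hstep.reachable.trans (ih (f z') (hn ▸ hlt) z' hz' rfl)
  have : Nonempty s := ⟨⟨r, hr⟩⟩
  exact ⟨fun u v => (key _ u.1 u.2 rfl).trans (key _ v.1 v.2 rfl).symm⟩

theorem exists_descent_of_induce_connected {s : Set V} (hs : (G.induce s).Connected) {c : V}
    (hc : c ∈ s) :
    ∃ f : V → ℕ, ∀ z ∈ s, z ≠ c → ∃ z' ∈ s, G.Adj z z' ∧ f z' < f z := by
  classical
  refine ⟨fun z => if h : z ∈ s then (G.induce s).dist ⟨z, h⟩ ⟨c, hc⟩ else 0, ?_⟩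
  intro z hz hzc
  obtain ⟨p, hp⟩ := hs.exists_walk_length_eq_dist ⟨z, hz⟩ ⟨c, hc⟩
  cases p with
  | nil => exact absurd rfl hzc
  | @cons _ w _ hadj q =>
    refine ⟨w.1, w.2, hadj, ?_⟩
    have hle := dist_le q
    rw [Walk.length_cons] at hp
    simp only [hz, w.2, dif_pos]
    exact lt_of_le_of_lt hle (by omega)

/-- If `c` is a cut vertex of the connected induced subgraph on `s`, then vertices farthest
from `c` in two different parts of `s \ {c}` are non-adjacent, and removing both keeps
`s` connected. -/
theorem exists_descent_avoiding_pair [Finite V] {s : Set V} (hs : (G.induce s).Connected) {c : V}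
    (hc : c ∈ s) (hne : (s \ {c}).Nonempty) (hcut : ¬ (G.induce (s \ {c})).Connected) :
    ∃ a b : V, a ∈ s \ {c} ∧ b ∈ s \ {c} ∧ a ≠ b ∧ ¬ G.Adj a b ∧
      ∃ f : V → ℕ, ∀ z ∈ s \ {a, b}, z ≠ c → ∃ z' ∈ s \ {a, b}, G.Adj z z' ∧ f z' < f z := by
  obtain ⟨f, hf⟩ := exists_descent_of_induce_connected hs hc
  have : Nonempty ↥(s \ {c}) := hne.to_subtype
  obtain ⟨p, q, hpq⟩ : ∃ p q, ¬ (G.induce (s \ {c})).Reachable p q := by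
    by_contra! hall
    exact hcut ⟨hall⟩
  let A : Set V := {z | ∃ h : z ∈ s \ {c}, (G.induce (s \ {c})).Reachable p ⟨z, h⟩}
  have hA : ∀ z w, z ∈ s \ {c} → w ∈ s \ {c} → G.Adj z w → z ∈ A → w ∈ A := by
    rintro z w hz hw hadj ⟨_, hpz⟩
    have hstep : (G.induce (s \ {c})).Adj ⟨z, hz⟩ ⟨w, hw⟩ := hadj
    exact ⟨hw, hpz.trans hstep.reachable⟩
  have hpA : p.1 ∈ A := ⟨p.2, Reachable.refl _⟩
  have hqA : q.1 ∉ A := fun ⟨_, h⟩ => hpq h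
  obtain ⟨a, haA, ha⟩ := Set.exists_max_image A f (Set.toFinite _) ⟨p.1, hpA⟩
  obtain ⟨b, ⟨hbs, hbA⟩, hb⟩ :=
    Set.exists_max_image ((s \ {c}) \ A) f (Set.toFinite _) ⟨q.1, q.2, hqA⟩
  have has : a ∈ s \ {c} := haA.1
  refine ⟨a, b, has, hbs, fun h => hbA (h ▸ haA), fun h => hbA (hA a b has hbs h haA), f, ?_⟩
  rintro z ⟨hzs, -⟩ hzc
  obtain ⟨z', hz's, hadj, hlt⟩ := hf z hzs hzc
  refine ⟨z', ⟨hz's, ?_⟩, hadj, hlt⟩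
  rintro (rfl | rfl)
  · exact absurd (ha z (hA _ _ has ⟨hzs, hzc⟩ hadj.symm haA)) (not_le.2 hlt)
  · exact absurd (hb z ⟨⟨hzs, hzc⟩, fun h => hbA (hA _ _ ⟨hzs, hzc⟩ hbs hadj h)⟩) (not_le.2 hlt)

end SimpleGraph

open SimpleGraph in
theorem stmt14 {V : Type*} [Fintype V] [DecidableEq V] (G : SimpleGraph V)
    [DecidableRel G.Adj]
    (hn : 3 ≤ Fintype.card V) (hconn : G.Connected)
    (hnc : G ≠ ⊤)
    (hncyc : ¬ (G.Connected ∧ ∀ v, G.degree v = 2)) :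
    ∃ u₁ u₂ : V, u₁ ≠ u₂ ∧ ¬ G.Adj u₁ u₂ ∧
      (G.induce {w | w ≠ u₁ ∧ w ≠ u₂}).Connected := by
  have huniv : (G.induce Set.univ).Connected := (induceUnivIso G).connected_iff.2 hconn
  have hother : ∀ x y : V, ∃ z, z ≠ x ∧ z ≠ y := by
    intro x y
    obtain ⟨z, hz⟩ := Finset.exists_mem_notMem_of_card_lt_card
      (s := {x, y}) (t := Finset.univ) (lt_of_le_of_lt Finset.card_le_two
        (by rw [Finset.card_univ]; omega))
    exact ⟨z, by simpa using hz⟩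
  by_cases hcutv : ∃ c, ¬ (G.induce {c}ᶜ).Connected
  · obtain ⟨c, hc⟩ := hcutv
    rw [Set.compl_eq_univ_sdiff] at hc
    obtain ⟨z, hz, -⟩ := hother c c
    obtain ⟨a, b, ha, hb, hab, hadj, f, hf⟩ :=
      exists_descent_avoiding_pair huniv (Set.mem_univ c) ⟨z, trivial, hz⟩ hc
    refine ⟨a, b, hab, hadj, induce_connected_of_descent (r := c)
      ⟨fun h => ha.2 h.symm, fun h => hb.2 h.symm⟩ f ?_⟩
    intro z hz hzc
    obtain ⟨z', hz', h⟩ := hf z ⟨trivial, by simpa using hz⟩ hzc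
    exact ⟨z', by simpa using hz', h⟩
  push Not at hcutv
  obtain ⟨x, hx⟩ : ∃ x, G.degree x ≠ 2 := by
    by_contra! h
    exact hncyc ⟨hconn, h⟩
  by_cases hxu : ∀ y, y ≠ x → G.Adj x y
  · obtain ⟨u, v, huv, hadj⟩ : ∃ u v, u ≠ v ∧ ¬ G.Adj u v := by
      by_contra! h
      exact hnc (by ext u v; exact ⟨fun h => h.ne, h u v⟩)
    have hux : x ≠ u := by
      rintro rfl
      exact hadj (hxu v huv.symm)
    have hvx : x ≠ v := by
      rintro rfl
      exact hadj (hxu u huv).symm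
    refine ⟨u, v, huv, hadj, induce_connected_of_descent (r := x) ⟨hux, hvx⟩
      (fun z => if z = x then 0 else 1) ?_⟩
    intro z _ hzx
    exact ⟨x, ⟨hux, hvx⟩, (hxu z hzx).symm, by simp [hzx]⟩
  push Not at hxu
  obtain ⟨y, hyx, hxy⟩ := hxu
  have hdeg : ∀ c, ∃ w, w ≠ c ∧ G.Adj x w := by
    intro c
    by_cases hcx : c = x
    · obtain ⟨w, hw⟩ : ∃ w, G.Adj x w := by
        have : Nontrivial V := ⟨⟨y, x, hyx⟩⟩
        exact hconn.preconnected.exists_adj_of_nontrivial x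
      exact ⟨w, fun h => hw.ne (hcx ▸ h.symm), hw⟩
    · obtain ⟨z, hzx, hzc⟩ := hother x c
      have : Nontrivial ↥({c}ᶜ : Set V) :=
        ⟨⟨⟨x, fun h => hcx h.symm⟩, ⟨z, hzc⟩, fun h => hzx (congrArg Subtype.val h).symm⟩⟩
      obtain ⟨w, hw⟩ := (hcutv c).preconnected.exists_adj_of_nontrivial ⟨x, fun h => hcx h.symm⟩
      exact ⟨w.1, w.2, hw⟩
  by_cases hbad : (G.induce {w | w ≠ x ∧ w ≠ y}).Connected
  · exact ⟨x, y, hyx.symm, hxy, hbad⟩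
  have hset : ({x}ᶜ : Set V) \ {y} = {w | w ≠ x ∧ w ≠ y} := rfl
  obtain ⟨z, hzx, hzy⟩ := hother x y
  obtain ⟨a, b, ⟨hax, hay⟩, ⟨hbx, hby⟩, hab, hadj, f, hf⟩ :=
    exists_descent_avoiding_pair (hcutv x) (c := y) hyx ⟨z, hzx, hzy⟩ (hset ▸ hbad)
  obtain ⟨w, hwa, hwb, hxw⟩ : ∃ w, w ≠ a ∧ w ≠ b ∧ G.Adj x w := by
    by_contra! h
    obtain ⟨b', hb', hxb⟩ := hdeg a
    obtain ⟨a', ha', hxa⟩ := hdeg b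
    obtain rfl : b' = b := by_contra fun hne => h b' hb' hne hxb
    obtain rfl : a' = a := by_contra fun hne => h a' hne ha' hxa
    apply hx
    rw [← card_neighborFinset_eq_degree, Finset.card_eq_two]
    refine ⟨a', b', hab, ?_⟩
    ext t
    simp only [mem_neighborFinset, Finset.mem_insert, Finset.mem_singleton]
    constructor
    · intro ht
      by_contra! hne
      exact h t hne.1 hne.2 ht
    · rintro (rfl | rfl) <;> assumption
  refine ⟨a, b, hab, hadj, induce_connected_of_descent (r := y)
    ⟨fun h => hay h.symm, fun h => hby h.symm⟩ (fun z => if z = x then f w + 1 else f z) ?_⟩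
  intro z hz hzy
  by_cases hzx : z = x
  · subst hzx
    exact ⟨w, ⟨hwa, hwb⟩, hxw, by simp [hxw.ne']⟩
  · obtain ⟨z', ⟨hz'x, hz'⟩, hadj', hlt⟩ := hf z ⟨hzx, by simpa using hz⟩ hzy
    refine ⟨z', by simpa using hz', hadj', ?_⟩
    have hne : z' ≠ x := hz'x
    simpa [hzx, hne] using hlt
end
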